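/- arXiv:math/0409464 — 6 statements merged into one kernel-verified Lean document; each statement's English description precedes it below -/
import Mathlib

section
/- Let k ≥ 1. Suppose a, b : [-1,1] → ℂ extend to holomorphic functions on an open set containing the closed ellipse E ⊂ ℂ with foci ±1 and semiaxes S, s satisfying S + s = e^η > 1. Set A_E = max_{z∈E} |∫_{-1}^z a(ζ) dζ| and B_E = max_{z∈E} |∫_{-1}^z b(ζ) dζ| (the integrals taken along paths in E from −1 to z). Suppose x : [-1,1] → ℂ is continuous with U x = λ x for some λ ≠ 0, and ‖x‖_{H¹} = 1. Let p be the polynomial of degree ≤ k interpolating x at the k+1 points cos(jπ/k), j = 0,…,k. Then ‖x − p‖_{H¹} ≤ 8·(sinh η)^{-1}·exp(A_E + B_E/|λ|)·k·e^{−kη}. -/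
open Set

/-- The fundamental solution `Φ_a(t) = exp(∫_{-1}^t a(s) ds)`. -/
noncomputable def Phi (a : ℝ → ℂ) (t : ℝ) : ℂ := Complex.exp (∫ s in (-1 : ℝ)..t, a s)

/-- The monodromy operator
`(U f)(t) = Φ_a(t)·[f(1) + ∫_{-1}^t Φ_a(s)⁻¹·b(s)·f(s) ds]`. -/
noncomputable def Uop (a b : ℝ → ℂ) (f : ℝ → ℂ) (t : ℝ) : ℂ :=
  Phi a t * (f 1 + ∫ s in (-1 : ℝ)..t, (Phi a s)⁻¹ * b s * f s)

/-- The normalized Chebyshev polynomials. -/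
noncomputable def That (k : ℕ) (t : ℝ) : ℝ :=
  if k = 0 then Real.sqrt (1 / Real.pi)
  else Real.sqrt (2 / Real.pi) * Real.cos (k * Real.arccos t)

/-- The Chebyshev expansion coefficients
`f̂_k = ∫_{-1}^1 T̂_k(t)·f(t)·(1−t²)^{-1/2} dt`. -/
noncomputable def chebCoeff (f : ℝ → ℂ) (k : ℕ) : ℂ :=
  ∫ t in (-1 : ℝ)..1, (That k t : ℂ) * f t * ((Real.sqrt (1 - t ^ 2) : ℝ) : ℂ)⁻¹

/-- The `H¹` norm `‖f‖_{H¹} = (Σ_k (1+k)²·|f̂_k|²)^{1/2}`. -/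
noncomputable def h1Norm (f : ℝ → ℂ) : ℝ :=
  Real.sqrt (∑' k : ℕ, ((1 : ℝ) + k) ^ 2 * ‖chebCoeff f k‖ ^ 2)

/-- The closed ellipse with foci `±1` and semiaxes `S` (major) and `s` (minor). -/
def ellipse (S s : ℝ) : Set ℂ :=
  {z : ℂ | z.re ^ 2 / S ^ 2 + z.im ^ 2 / s ^ 2 ≤ 1}

/-- The integral `∫_{-1}^z g(ζ) dζ` taken along the straight segment from `-1` to `z`. -/
noncomputable def segInt (g : ℂ → ℂ) (z : ℂ) : ℂ :=
  (z + 1) * ∫ s in (0 : ℝ)..1, g (-1 + (s : ℂ) * (z + 1))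

/-- Fourier coefficient of a `2π`-periodic function. -/
noncomputable def fc (h : ℝ → ℂ) (n : ℤ) : ℂ :=
  (1 / (2 * Real.pi) : ℝ) • ∫ θ in (-Real.pi)..Real.pi, Complex.exp (-(n * θ * Complex.I)) * h θ

noncomputable def toCirc (h : ℝ → ℂ) (hc : Continuous h) (hp : Function.Periodic h (2 * Real.pi)) :
    C(AddCircle (2 * Real.pi), ℂ) where
  toFun := hp.lift
  continuous_toFun := continuous_coinduced_dom.mpr hc

instance factTwoPi : Fact (0 < 2 * Real.pi) := ⟨by positivity⟩

lemma fc_eq (h : ℝ → ℂ) (hc : Continuous h) (hp : Function.Periodic h (2 * Real.pi)) (n : ℤ) :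
    fourierCoeff (toCirc h hc hp) n = fc h n := by
  rw [fourierCoeff_eq_intervalIntegral _ _ (-Real.pi), fc]
  congr 1
  rw [show -Real.pi + 2 * Real.pi = Real.pi by ring]
  apply intervalIntegral.integral_congr
  intro θ _
  simp only [smul_eq_mul, toCirc, ContinuousMap.coe_mk, Function.Periodic.lift_coe]
  rw [fourier_coe_apply]
  congr 2
  push_cast
  have : (Real.pi : ℂ) ≠ 0 := by exact_mod_cast Real.pi_ne_zero
  field_simp

lemma fc_hasSum (h : ℝ → ℂ) (hc : Continuous h) (hp : Function.Periodic h (2 * Real.pi))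
    (hs : Summable (fc h)) (θ : ℝ) :
    HasSum (fun n : ℤ => fc h n * Complex.exp (n * θ * Complex.I)) (h θ) := by
  have hs' : Summable (fourierCoeff (toCirc h hc hp)) := by
    convert hs using 1; ext n; exact fc_eq h hc hp n
  have := has_pointwise_sum_fourier_series_of_summable hs' (θ : AddCircle (2 * Real.pi))
  have h0 : toCirc h hc hp (θ : AddCircle (2 * Real.pi)) = h θ := by
    simp [toCirc]
  rw [h0] at this
  convert this using 1
  ext n
  rw [fc_eq, smul_eq_mul, fourier_coe_apply]
  congr 2
  push_cast
  have : (Real.pi : ℂ) ≠ 0 := by exact_mod_cast Real.pi_ne_zero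
  field_simp

lemma fc_bessel (h : ℝ → ℂ) (hc : Continuous h) (hp : Function.Periodic h (2 * Real.pi))
    (M : ℝ) (hM : ∀ θ, ‖h θ‖ ≤ M) :
    Summable (fun n : ℤ => ‖fc h n‖ ^ 2) ∧ ∑' n : ℤ, ‖fc h n‖ ^ 2 ≤ M ^ 2 := by
  have H := hasSum_sq_fourierCoeff
    (ContinuousMap.toLp (E := ℂ) 2 AddCircle.haarAddCircle ℂ (toCirc h hc hp))
  simp_rw [fourierCoeff_toLp, fc_eq] at H
  refine ⟨H.summable, ?_⟩
  rw [H.tsum_eq]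
  have h1 : ∫ t : AddCircle (2 * Real.pi),
      ‖(ContinuousMap.toLp (E := ℂ) 2 AddCircle.haarAddCircle ℂ (toCirc h hc hp)) t‖ ^ 2
        ∂AddCircle.haarAddCircle
      = ∫ t : AddCircle (2 * Real.pi), ‖toCirc h hc hp t‖ ^ 2 ∂AddCircle.haarAddCircle := by
    apply MeasureTheory.integral_congr_ae
    filter_upwards [ContinuousMap.coeFn_toAEEqFun AddCircle.haarAddCircle (toCirc h hc hp)] with t ht
    rw [← ht]; rfl
  rw [h1]
  have h2 : ∀ t, ‖toCirc h hc hp t‖ ^ 2 ≤ M ^ 2 := by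
    intro t
    induction t using QuotientAddGroup.induction_on with
    | H z =>
      have : toCirc h hc hp (z : AddCircle (2 * Real.pi)) = h z := by
        simp [toCirc]
      have h3 := hM z
      rw [show toCirc h hc hp (QuotientAddGroup.mk z) = h z from this]
      gcongr
  calc _ ≤ ∫ t : AddCircle (2 * Real.pi), M ^ 2 ∂AddCircle.haarAddCircle := by
        apply MeasureTheory.integral_mono_of_nonneg
        · exact Filter.Eventually.of_forall fun t => by positivity
        · exact MeasureTheory.integrable_const _
        · exact Filter.Eventually.of_forall h2
    _ = M ^ 2 := by simp

lemma fc_neg (h : ℝ → ℂ) (he : ∀ θ, h (-θ) = h θ) (n : ℤ) : fc h (-n) = fc h n := by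
  unfold fc
  congr 1
  have := intervalIntegral.integral_comp_neg (a := -Real.pi) (b := Real.pi)
    (fun θ : ℝ => Complex.exp (-(n * θ * Complex.I)) * h θ)
  rw [neg_neg] at this
  rw [← this]
  apply intervalIntegral.integral_congr
  intro θ _
  simp [he]

lemma fc_even (h : ℝ → ℂ) (hc : Continuous h) (he : ∀ θ, h (-θ) = h θ) (n : ℤ) :
    ∫ θ in (0:ℝ)..Real.pi, Complex.cos (n * θ) * h θ = Real.pi * fc h n := by
  have h1 : fc h n + fc h (-n) = 2 * fc h n := by rw [fc_neg h he]; ring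
  have h2 : fc h n + fc h (-n) = (1 / (2 * Real.pi) : ℝ) •
      ∫ θ in (-Real.pi)..Real.pi, 2 * (Complex.cos (n * θ) * h θ) := by
    unfold fc
    rw [← smul_add, ← intervalIntegral.integral_add]
    · congr 1
      apply intervalIntegral.integral_congr
      intro θ _
      simp only [Complex.cos]
      push_cast
      rw [show -(-(n:ℂ) * θ * Complex.I) = n * θ * Complex.I by ring,
        show -((n:ℂ) * θ) * Complex.I = -(n * θ * Complex.I) by ring]
      ring
    · apply Continuous.intervalIntegrable; fun_prop
    · apply Continuous.intervalIntegrable; fun_prop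
  have hI : ∀ a b, IntervalIntegrable (fun θ : ℝ => Complex.cos (n * θ) * h θ) MeasureTheory.volume a b := by
    intro a b; apply Continuous.intervalIntegrable; fun_prop
  have h3 : ∫ θ in (-Real.pi)..Real.pi, (Complex.cos (n * θ) * h θ) =
     2 * ∫ θ in (0:ℝ)..Real.pi, Complex.cos (n * θ) * h θ := by
    rw [← intervalIntegral.integral_add_adjacent_intervals (hI (-Real.pi) 0) (hI 0 Real.pi)]
    have := intervalIntegral.integral_comp_neg (a := 0) (b := Real.pi)
      (fun θ : ℝ => Complex.cos (n * θ) * h θ)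
    rw [neg_zero] at this
    rw [← this, two_mul]
    congr 1
    apply intervalIntegral.integral_congr
    intro θ _
    simp [he]
  rw [intervalIntegral.integral_const_mul, h3] at h2
  rw [h1] at h2
  have : (Real.pi : ℂ) ≠ 0 := by exact_mod_cast Real.pi_ne_zero
  rw [Complex.real_smul] at h2
  push_cast at h2
  field_simp at h2
  linear_combination -h2

lemma fc_bound (h : ℝ → ℂ) (hc : Continuous h) (hp : Function.Periodic h (2 * Real.pi))
    (M : ℝ) (hM : ∀ θ, ‖h θ‖ ≤ M) (n : ℤ) : ‖fc h n‖ ≤ M := by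
  obtain ⟨h1, h2⟩ := fc_bessel h hc hp M hM
  have h3 := (h1.le_tsum n (fun _ _ => by positivity)).trans h2
  exact abs_le_of_sq_le_sq' h3 ((norm_nonneg _).trans (hM 0)) |>.2

/-- `cos ^ i` has no Fourier modes above `i`. -/
lemma fc_cos_pow (i : ℕ) : ∀ m : ℤ, (i : ℤ) < |m| → fc (fun θ => (Real.cos θ : ℂ) ^ i) m = 0 := by
  have key : ∀ m : ℤ, m ≠ 0 → ∫ θ in (-Real.pi)..Real.pi, Complex.exp (-(m * θ * Complex.I)) = 0 := by
    intro m hm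
    have hm' : (m : ℂ) ≠ 0 := by exact_mod_cast hm
    have hc : -((m:ℂ) * Complex.I) ≠ 0 := by simp [hm']
    have := integral_exp_mul_complex (a := -Real.pi) (b := Real.pi) hc
    have e : ∀ θ : ℝ, -((m:ℂ) * θ * Complex.I) = -((m:ℂ) * Complex.I) * θ := fun θ => by ring
    simp_rw [e]
    rw [this, div_eq_zero_iff]
    left
    rw [sub_eq_zero, Complex.exp_eq_exp_iff_exists_int]
    exact ⟨-m, by push_cast; ring⟩
  induction i with
  | zero =>
    intro m hm
    have : m ≠ 0 := by simpa using hm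
    simp [fc, key m this]
  | succ i ih =>
    intro m hm
    have h1 := ih (m - 1) (by push_cast at hm; rcases abs_cases m with h | h <;> rcases abs_cases (m-1) with h' | h' <;> omega)
    have h2 := ih (m + 1) (by push_cast at hm; rcases abs_cases m with h | h <;> rcases abs_cases (m+1) with h' | h' <;> omega)
    have : fc (fun θ => (Real.cos θ : ℂ) ^ (i+1)) m = (1/2 : ℂ) * (fc (fun θ => (Real.cos θ : ℂ) ^ i) (m-1)
      + fc (fun θ => (Real.cos θ : ℂ) ^ i) (m+1)) := by
      unfold fc
      rw [← smul_add, ← intervalIntegral.integral_add, mul_smul_comm, ← intervalIntegral.integral_const_mul]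
      · congr 1
        apply intervalIntegral.integral_congr
        intro θ _
        simp only [Complex.ofReal_cos, Complex.cos]
        push_cast
        rw [show -(((m:ℂ) - 1) * θ * Complex.I) = -(m * θ * Complex.I) + θ * Complex.I by ring,
          show -(((m:ℂ) + 1) * θ * Complex.I) = -(m * θ * Complex.I) + -θ * Complex.I by ring,
          Complex.exp_add, Complex.exp_add]
        ring
      · apply Continuous.intervalIntegrable; fun_prop
      · apply Continuous.intervalIntegrable; fun_prop
    rw [this, h1, h2]; simp

lemma fc_sub (f g : ℝ → ℂ) (hf : Continuous f) (hg : Continuous g) (n : ℤ) :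
    fc (fun θ => f θ - g θ) n = fc f n - fc g n := by
  unfold fc
  rw [← smul_sub, ← intervalIntegral.integral_sub]
  · congr 1
    apply intervalIntegral.integral_congr
    intro θ _
    simp only; ring
  · apply Continuous.intervalIntegrable; fun_prop
  · apply Continuous.intervalIntegrable; fun_prop

lemma fc_poly (p : Polynomial ℂ) (k : ℕ) (hp : p.natDegree ≤ k) (m : ℤ) (hm : (k : ℤ) < |m|) :
    fc (fun θ => p.eval ((Real.cos θ : ℝ) : ℂ)) m = 0 := by
  have h : ∀ θ : ℝ, p.eval ((Real.cos θ : ℝ) : ℂ) =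
      ∑ i ∈ Finset.range (k+1), p.coeff i * (Real.cos θ : ℂ) ^ i := fun θ =>
    Polynomial.eval_eq_sum_range' (by omega) _
  have h2 : fc (fun θ => p.eval ((Real.cos θ : ℝ) : ℂ)) m =
      ∑ i ∈ Finset.range (k+1), p.coeff i * fc (fun θ => (Real.cos θ : ℂ) ^ i) m := by
    unfold fc
    simp_rw [mul_smul_comm]
    rw [← Finset.smul_sum]
    congr 1
    simp_rw [h, Finset.mul_sum]
    rw [intervalIntegral.integral_finsetSum]
    · apply Finset.sum_congr rfl
      intro i _
      rw [← intervalIntegral.integral_const_mul]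
      apply intervalIntegral.integral_congr
      intro θ _
      simp only; ring
    · intro i _
      apply Continuous.intervalIntegrable; fun_prop
  rw [h2]
  apply Finset.sum_eq_zero
  intro i hi
  rw [fc_cos_pow i m (by simp at hi; omega), mul_zero]

lemma fc_eq_zero_two_pi (h : ℝ → ℂ) (hp : Function.Periodic h (2 * Real.pi)) (n : ℤ) :
    fc h n = (1 / (2 * Real.pi) : ℝ) •
      ∫ θ in (0:ℝ)..(2 * Real.pi), Complex.exp (-(n * θ * Complex.I)) * h θ := by
  unfold fc
  congr 1
  have hper : Function.Periodic (fun θ : ℝ => Complex.exp (-(n * θ * Complex.I)) * h θ) (2 * Real.pi) := by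
    intro θ
    simp only
    rw [hp θ]
    congr 1
    rw [Complex.exp_eq_exp_iff_exists_int]
    exact ⟨-n, by push_cast; ring⟩
  have := hper.intervalIntegral_add_eq (-Real.pi) 0
  rwa [zero_add, show -Real.pi + 2 * Real.pi = Real.pi by ring] at this

/-- The Joukowski map. -/
noncomputable def jouk (w : ℂ) : ℂ := (w + w⁻¹) / 2

lemma jouk_one (θ : ℝ) : jouk (Complex.exp (θ * Complex.I)) = ((Real.cos θ : ℝ) : ℂ) := by
  rw [jouk, ← Complex.exp_neg, Complex.ofReal_cos, Complex.cos]
  congr 3; ring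

lemma jouk_polar (ρ φ : ℝ) : jouk (ρ * Complex.exp (φ * Complex.I)) =
    (((ρ + ρ⁻¹) / 2 * Real.cos φ : ℝ) : ℂ) + (((ρ - ρ⁻¹) / 2 * Real.sin φ : ℝ) : ℂ) * Complex.I := by
  rw [jouk, mul_inv, ← Complex.exp_neg, ← neg_mul, Complex.exp_mul_I, Complex.exp_mul_I]
  push_cast
  rw [Complex.cos_neg, Complex.sin_neg]
  ring

lemma ellipse_aux (S s : ℝ) (hs : 0 < s) (hfoci : S ^ 2 = s ^ 2 + 1) (hgt : 1 < S + s) :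
    0 < S ∧ (S + s)⁻¹ = S - s := by
  have h1 : (S + s) * (S - s) = 1 := by nlinarith
  refine ⟨?_, ?_⟩
  · by_contra h
    nlinarith [abs_nonneg S]
  · exact inv_eq_of_mul_eq_one_right h1

lemma jouk_mem (S s : ℝ) (hs : 0 < s) (hfoci : S ^ 2 = s ^ 2 + 1) (hgt : 1 < S + s)
    (w : ℂ) (h1 : 1 ≤ ‖w‖) (h2 : ‖w‖ ≤ S + s) : jouk w ∈ ellipse S s := by
  obtain ⟨hS, hinv⟩ := ellipse_aux S s hs hfoci hgt
  rw [← Complex.norm_mul_exp_arg_mul_I w, jouk_polar]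
  set ρ := ‖w‖
  set φ := w.arg
  have hρ : 0 < ρ := by linarith
  have hi : S - s ≤ ρ⁻¹ := by rw [← hinv]; gcongr
  have hi1 : ρ⁻¹ ≤ 1 := inv_le_one_of_one_le₀ h1
  have hmul : ρ * ρ⁻¹ = 1 := mul_inv_cancel₀ hρ.ne'
  have e1 : (ρ + ρ⁻¹) / 2 ≤ S := by
    have : (S + s) * (S - s) = 1 := by nlinarith
    nlinarith
  have e2 : (ρ - ρ⁻¹) / 2 ≤ s := by linarith
  simp only [ellipse, mem_ofPred_eq, Complex.add_re, Complex.add_im, Complex.ofReal_re,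
    Complex.ofReal_im, Complex.re_ofReal_mul, Complex.im_ofReal_mul, Complex.I_re, Complex.I_im]
  have f1 : ((ρ + ρ⁻¹) / 2 * Real.cos φ + (ρ - ρ⁻¹) / 2 * Real.sin φ * 0) ^ 2 / S ^ 2 ≤ Real.cos φ ^ 2 := by
    rw [div_le_iff₀ (by positivity), mul_zero, add_zero, mul_pow, mul_comm]
    gcongr
  have f2 : (0 + (ρ - ρ⁻¹) / 2 * Real.sin φ * 1) ^ 2 / s ^ 2 ≤ Real.sin φ ^ 2 := by
    rw [div_le_iff₀ (by positivity), mul_one, zero_add, mul_pow, mul_comm]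
    have : 0 ≤ (ρ - ρ⁻¹) / 2 := by linarith
    gcongr
  linarith [Real.sin_sq_add_cos_sq φ]

lemma jouk_mem_strict (S s : ℝ) (hs : 0 < s) (hfoci : S ^ 2 = s ^ 2 + 1) (hgt : 1 < S + s)
    (w : ℂ) (h1 : 1 ≤ ‖w‖) (h2 : ‖w‖ < S + s) :
    (jouk w).re ^ 2 / S ^ 2 + (jouk w).im ^ 2 / s ^ 2 < 1 := by
  obtain ⟨hS, hinv⟩ := ellipse_aux S s hs hfoci hgt
  rw [← Complex.norm_mul_exp_arg_mul_I w, jouk_polar]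
  set ρ := ‖w‖
  set φ := w.arg
  have hρ : 0 < ρ := by linarith
  have hi : S - s < ρ⁻¹ := by rw [← hinv]; gcongr
  have hi1 : ρ⁻¹ ≤ 1 := inv_le_one_of_one_le₀ h1
  have hmul : ρ * ρ⁻¹ = 1 := mul_inv_cancel₀ hρ.ne'
  have e1 : (ρ + ρ⁻¹) / 2 < S := by
    have : (S + s) * (S - s) = 1 := by nlinarith
    nlinarith
  have e2 : (ρ - ρ⁻¹) / 2 < s := by linarith
  simp only [Complex.add_re, Complex.add_im, Complex.ofReal_re,
    Complex.ofReal_im, Complex.re_ofReal_mul, Complex.im_ofReal_mul, Complex.I_re, Complex.I_im]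
  set A := (ρ + ρ⁻¹) / 2 with hA
  set B := (ρ - ρ⁻¹) / 2
  have hA0 : 0 < A := by positivity
  have hB0 : 0 ≤ B := by simp only [B]; linarith
  have g1 : A ^ 2 / S ^ 2 < 1 := by
    rw [div_lt_one (by positivity)]; gcongr
  have g2 : B ^ 2 / s ^ 2 < 1 := by
    rw [div_lt_one (by positivity)]; gcongr
  have e3 : (A * Real.cos φ + B * Real.sin φ * 0) ^ 2 / S ^ 2
      + (0 + B * Real.sin φ * 1) ^ 2 / s ^ 2 = A ^ 2 / S ^ 2 * Real.cos φ ^ 2 + B ^ 2 / s ^ 2 * Real.sin φ ^ 2 := by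
    ring
  rw [e3]
  have := Real.sin_sq_add_cos_sq φ
  rcases lt_or_eq_of_le (sq_nonneg (Real.cos φ)) with h | h
  · nlinarith [sq_nonneg (Real.sin φ)]
  · nlinarith [sq_nonneg (Real.sin φ)]

lemma circle_int (Y : ℂ → ℂ) (m : ℕ) (R : ℝ) (hR : 0 < R) :
    (∮ w in C(0, R), (w ^ (m + 1))⁻¹ * Y (jouk w)) * R ^ m =
      Complex.I * (2 * Real.pi) * fc (fun θ => Y (jouk (R * Complex.exp (θ * Complex.I)))) m := by
  rw [fc_eq_zero_two_pi]
  · rw [circleIntegral, Complex.real_smul]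
    have hpi : (Real.pi : ℂ) ≠ 0 := by exact_mod_cast Real.pi_ne_zero
    have hR' : (R : ℂ) ≠ 0 := by exact_mod_cast hR.ne'
    push_cast
    rw [← mul_assoc, show Complex.I * (2 * (Real.pi : ℂ)) * (1 / (2 * Real.pi)) = Complex.I by field_simp,
      mul_comm _ ((R : ℂ) ^ m), ← intervalIntegral.integral_const_mul, ← intervalIntegral.integral_const_mul]
    apply intervalIntegral.integral_congr
    intro θ _
    simp only [deriv_circleMap, circleMap_zero, smul_eq_mul]
    have he := Complex.exp_ne_zero (θ * Complex.I)
    rw [Complex.exp_neg, mul_assoc (m : ℂ), Complex.exp_nat_mul]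
    field_simp
    ring
  · intro θ
    simp only
    congr 3
    rw [Complex.exp_eq_exp_iff_exists_int]
    exact ⟨1, by push_cast; ring⟩

lemma shift (S s : ℝ) (hs : 0 < s) (hfoci : S ^ 2 = s ^ 2 + 1) (hgt : 1 < S + s)
    (Y : ℂ → ℂ) (hY : ContinuousOn Y (ellipse S s))
    (hYd : ∀ z : ℂ, z.re ^ 2 / S ^ 2 + z.im ^ 2 / s ^ 2 < 1 → DifferentiableAt ℂ Y z) (m : ℕ) :
    fc (fun θ => Y (jouk (((S + s : ℝ) : ℂ) * Complex.exp (θ * Complex.I)))) m =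
     fc (fun θ => Y ((Real.cos θ : ℝ) : ℂ)) m * ((S + s : ℝ) : ℂ) ^ m := by
  have hR : 0 < S + s := by linarith
  have h1 := circle_int Y m (S + s) hR
  have h2 := circle_int Y m 1 one_pos
  simp only [Complex.ofReal_one, one_mul, one_pow, mul_one, jouk_one] at h2
  have h3 : (∮ w in C(0, S + s), (w ^ (m + 1))⁻¹ * Y (jouk w)) =
      ∮ w in C(0, 1), (w ^ (m + 1))⁻¹ * Y (jouk w) := by
    apply Complex.circleIntegral_eq_of_differentiable_on_annulus_off_countable one_pos hgt.le
      (s := ∅) countable_empty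
    · have hne : ∀ w ∈ Metric.closedBall (0:ℂ) (S + s) \ Metric.ball 0 1, w ≠ 0 := by
        rintro w ⟨-, hw⟩ rfl
        simp at hw
      apply ContinuousOn.mul
      · apply ContinuousOn.inv₀ (by fun_prop)
        intro w hw; exact pow_ne_zero _ (hne w hw)
      · apply hY.comp
        · unfold jouk
          apply ContinuousOn.div_const
          exact continuousOn_id.add (continuousOn_id.inv₀ hne)
        · rintro w ⟨hw1, hw2⟩
          apply jouk_mem S s hs hfoci hgt
          · simpa using hw2
          · simpa using hw1
    · rintro w ⟨⟨hw1, hw2⟩, -⟩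
      have hw1' : ‖w‖ < S + s := by simpa using hw1
      have hw2' : 1 < ‖w‖ := by simpa using hw2
      have hw0 : w ≠ 0 := by rintro rfl; simp at hw2'; linarith
      apply DifferentiableAt.mul
      · exact DifferentiableAt.inv (by fun_prop) (pow_ne_zero _ hw0)
      · have hj : DifferentiableAt ℂ jouk w := by
          unfold jouk
          exact (differentiableAt_id.add (differentiableAt_inv hw0)).div_const 2
        exact DifferentiableAt.comp w (hYd _ (jouk_mem_strict S s hs hfoci hgt w hw2'.le hw1')) hj
  have hpi : Complex.I * (2 * (Real.pi : ℂ)) ≠ 0 := by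
    have : (Real.pi : ℂ) ≠ 0 := by exact_mod_cast Real.pi_ne_zero
    simp [this]
  rw [h3, h2] at h1
  apply mul_left_cancel₀ hpi
  rw [← h1]; ring

lemma cos_cont (f : ℝ → ℂ) (hf : ContinuousOn f (Icc (-1) 1)) : Continuous (fun θ => f (Real.cos θ)) :=
  hf.comp_continuous Real.continuous_cos (fun θ => ⟨Real.neg_one_le_cos θ, Real.cos_le_one θ⟩)

lemma chebCoeff_cos (f : ℝ → ℂ) (m : ℕ) :
    chebCoeff f m = ∫ θ in (0:ℝ)..Real.pi, (That m (Real.cos θ) : ℂ) * f (Real.cos θ) := by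
  unfold chebCoeff
  have h := intervalIntegral.integral_deriv_smul_comp_of_deriv_nonpos (a := 1) (b := -1)
    (f := Real.arccos) (f' := fun x => -(1 / √(1 - x ^ 2)))
    (g := fun θ => (That m (Real.cos θ) : ℂ) * f (Real.cos θ)) (by fun_prop)
    (fun x hx ↦ (Real.hasDerivAt_arccos (by simp at hx; linarith) (by simp at hx; linarith)))
    (by intro x _; simp)
  rw [Real.arccos_one, Real.arccos_neg_one] at h
  rw [← h, intervalIntegral.integral_symm, ← intervalIntegral.integral_neg]
  apply intervalIntegral.integral_congr
  intro t ht
  rw [uIcc_of_ge (by norm_num)] at ht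
  simp only [Function.comp_apply, Real.cos_arccos ht.1 ht.2, Complex.real_smul]
  push_cast
  ring

lemma chebCoeff_fc (f : ℝ → ℂ) (hf : ContinuousOn f (Icc (-1) 1)) (m : ℕ) :
    chebCoeff f m = (if m = 0 then Real.sqrt Real.pi else Real.sqrt (2 * Real.pi) : ℝ) *
      fc (fun θ => f (Real.cos θ)) m := by
  have h := fc_even (fun θ => f (Real.cos θ)) (cos_cont f hf) (fun θ => by simp) m
  rw [chebCoeff_cos]
  have hpi := Real.pi_pos
  have e : ∫ θ in (0:ℝ)..Real.pi, (That m (Real.cos θ) : ℂ) * f (Real.cos θ) =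
     ((if m = 0 then Real.sqrt (1 / Real.pi) else Real.sqrt (2 / Real.pi) : ℝ) : ℂ) *
      ∫ θ in (0:ℝ)..Real.pi, Complex.cos ((m : ℤ) * θ) * f (Real.cos θ) := by
    rw [← intervalIntegral.integral_const_mul]
    apply intervalIntegral.integral_congr
    intro θ hθ
    rw [uIcc_of_le hpi.le] at hθ
    simp only [That]
    split_ifs with h0
    · simp [h0]
    · rw [Real.arccos_cos hθ.1 hθ.2]
      push_cast
      ring
  rw [e, h, ← mul_assoc, ← Complex.ofReal_mul]
  congr 2
  split_ifs
  · rw [Real.sqrt_div zero_le_one, Real.sqrt_one]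
    have : √Real.pi ≠ 0 := by positivity
    field_simp
    rw [Real.sq_sqrt hpi.le]
  · rw [Real.sqrt_div zero_le_two, Real.sqrt_mul zero_le_two]
    have : √Real.pi ≠ 0 := by positivity
    field_simp
    rw [Real.sq_sqrt hpi.le]

lemma fold_sum (N : ℕ) (hN : 0 < N) (e : ℤ → ℂ)
    (h0 : ∀ j < N, HasSum (fun m : ℤ => e m * Complex.exp (m * (2 * Real.pi * j / N : ℝ) * Complex.I)) 0)
    (n : ℤ) : HasSum (fun l : ℤ => e (n + N * l)) 0 := by
  have hN' : (N : ℂ) ≠ 0 := by exact_mod_cast hN.ne'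
  set ζ := Complex.exp (2 * Real.pi * Complex.I / N) with hζ
  have hprim : IsPrimitiveRoot ζ N := Complex.isPrimitiveRoot_exp N hN.ne'
  have hζ0 : ζ ≠ 0 := Complex.exp_ne_zero _
  have h1 : HasSum (fun m : ℤ => ∑ j ∈ Finset.range N, ζ ^ (-n * j) *
      (e m * Complex.exp (m * (2 * Real.pi * j / N : ℝ) * Complex.I))) (∑ j ∈ Finset.range N, ζ ^ (-n * j) * 0) := by
    apply hasSum_sum
    intro j hj
    exact (h0 j (Finset.mem_range.mp hj)).mul_left _
  simp only [mul_zero, Finset.sum_const_zero] at h1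
  have h2 : ∀ m : ℤ, ∑ j ∈ Finset.range N, ζ ^ (-n * j) *
      (e m * Complex.exp (m * (2 * Real.pi * j / N : ℝ) * Complex.I)) =
      e m * ∑ j ∈ Finset.range N, (ζ ^ (m - n)) ^ j := by
    intro m
    rw [Finset.mul_sum]
    apply Finset.sum_congr rfl
    intro j _
    have : Complex.exp (m * (2 * Real.pi * j / N : ℝ) * Complex.I) = ζ ^ (m * j) := by
      rw [hζ, ← Complex.exp_int_mul]
      congr 1
      push_cast
      ring
    rw [this, ← zpow_natCast (ζ ^ (m - n)) j, ← zpow_mul, sub_mul, sub_eq_neg_add, ← neg_mul, zpow_add₀ hζ0]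
    ring
  have h3 : ∀ m : ℤ, ∑ j ∈ Finset.range N, (ζ ^ (m - n)) ^ j = if (N : ℤ) ∣ m - n then (N : ℂ) else 0 := by
    intro m
    split_ifs with hd
    · rw [(hprim.zpow_eq_one_iff_dvd _).mpr hd]; simp
    · have hne : ζ ^ (m - n) ≠ 1 := fun h => hd ((hprim.zpow_eq_one_iff_dvd _).mp h)
      rw [geom_sum_eq hne, ← zpow_natCast, ← zpow_mul, mul_comm, zpow_mul, zpow_natCast, hprim.pow_eq_one]
      simp
  simp_rw [h2, h3] at h1
  have hinj : Function.Injective (fun l : ℤ => n + N * l) := by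
    intro a b hab
    have hz : N ≠ 0 := hN.ne'
    simpa [hz] using hab
  have h4 := (hinj.hasSum_iff (f := fun m : ℤ => e m * if (N : ℤ) ∣ m - n then (N : ℂ) else 0) (a := 0) (by
    intro m hm
    have : ¬ (N : ℤ) ∣ m - n := by
      rintro ⟨c, hc⟩
      exact hm ⟨c, by simp only; linarith⟩
    simp [this])).mpr h1
  have h5 := h4.mul_right (N : ℂ)⁻¹
  simpa [Function.comp_def, mul_assoc, hN'] using h5

/-- low-frequency coefficients of the interpolation error, `n < k` -/
lemma fold_bound (k : ℕ) (hk : 1 ≤ k) (e : ℤ → ℂ) (M q : ℝ) (hM : 0 ≤ M) (hq0 : 0 < q) (hq1 : q < 1)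
    (he : ∀ m : ℕ, k < m → ‖e m‖ ≤ M * q ^ m) (hev : ∀ m, e (-m) = e m)
    (hs : ∀ n : ℤ, HasSum (fun l : ℤ => e (n + (2 * k : ℕ) * l)) 0) (n : ℕ) (hn : n < k) :
    ‖e n‖ ≤ 2 * M * q ^ (2 * k - n) / (1 - q ^ (2 * k)) := by
  have hr0 : 0 ≤ q ^ (2 * k) := by positivity
  have hr1 : q ^ (2 * k) < 1 := pow_lt_one₀ hq0.le hq1 (by omega)
  have hg := (hasSum_geometric_of_lt_one hr0 hr1)
  have b1 : ∀ l : ℕ, ‖e (n + (2 * k : ℕ) * ((l : ℤ) + 1))‖ ≤ M * q ^ (2 * k - n) * (q ^ (2 * k)) ^ l := by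
    intro l
    have := he (n + 2 * k * (l + 1)) (by nlinarith)
    push_cast at this ⊢
    refine this.trans ?_
    rw [mul_assoc M, ← pow_mul, ← pow_add]
    apply mul_le_mul_of_nonneg_left _ hM
    apply pow_le_pow_of_le_one hq0.le hq1.le
    rw [mul_add]; omega
  have b2 : ∀ l : ℕ, ‖e (n + (2 * k : ℕ) * (-((l : ℤ) + 1)))‖ ≤ M * q ^ (2 * k - n) * (q ^ (2 * k)) ^ l := by
    intro l
    have := he (2 * k * l + (2 * k - n)) (by have := Nat.zero_le (2 * k * l); omega)
    rw [← hev] at this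
    have e1 : (-((2 * k * l + (2 * k - n) : ℕ) : ℤ)) = (n + (2 * k : ℕ) * (-((l : ℤ) + 1))) := by
      rw [Nat.cast_add, Nat.cast_sub (by omega)]; push_cast; ring
    rw [e1] at this
    refine this.trans (le_of_eq ?_)
    rw [mul_assoc M, ← pow_mul, ← pow_add, add_comm]
  have g1 := (hg.mul_left (M * q ^ (2 * k - n)))
  have s1 : Summable (fun l : ℕ => e (n + (2 * k : ℕ) * ((l : ℤ) + 1))) := .of_norm_bounded g1.summable b1
  have s2 : Summable (fun l : ℕ => e (n + (2 * k : ℕ) * (-((l : ℤ) + 1)))) := .of_norm_bounded g1.summable b2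
  have t1 := tsum_of_norm_bounded g1 b1
  have t2 := tsum_of_norm_bounded g1 b2
  have H := HasSum.of_add_one_of_neg_add_one (f := fun l : ℤ => e (n + (2 * k : ℕ) * l)) s1.hasSum s2.hasSum
  have H0 := H.unique (hs n)
  simp only [mul_zero, add_zero] at H0
  have : e n = -((∑' l : ℕ, e (n + (2 * k : ℕ) * ((l : ℤ) + 1))) + ∑' l : ℕ, e (n + (2 * k : ℕ) * (-((l : ℤ) + 1)))) := by
    linear_combination H0
  rw [this, norm_neg]
  refine (norm_add_le _ _).trans ((add_le_add t1 t2).trans (le_of_eq ?_))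
  rw [div_eq_mul_inv]; ring

lemma fold_bound_top (k : ℕ) (hk : 1 ≤ k) (e : ℤ → ℂ) (M q : ℝ) (hq0 : 0 < q) (hq1 : q < 1)
    (he : ∀ m : ℕ, k < m → ‖e m‖ ≤ M * q ^ m) (hev : ∀ m, e (-m) = e m)
    (hs : ∀ n : ℤ, HasSum (fun l : ℤ => e (n + (2 * k : ℕ) * l)) 0) :
    ‖e k‖ ≤ M * q ^ (3 * k) / (1 - q ^ (2 * k)) := by
  have hr0 : 0 ≤ q ^ (2 * k) := by positivity
  have hr1 : q ^ (2 * k) < 1 := pow_lt_one₀ hq0.le hq1 (by omega)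
  have hg := (hasSum_geometric_of_lt_one hr0 hr1)
  have b1 : ∀ l : ℕ, ‖e (k + (2 * k : ℕ) * ((l + 1 : ℕ) : ℤ))‖ ≤ M * q ^ (3 * k) * (q ^ (2 * k)) ^ l := by
    intro l
    have := he (k + 2 * k * (l + 1)) (by nlinarith)
    push_cast at this ⊢
    refine this.trans (le_of_eq ?_)
    rw [mul_assoc M, ← pow_mul, ← pow_add]
    congr 2; ring
  have g1 := (hg.mul_left (M * q ^ (3 * k)))
  have s1 : Summable (fun l : ℕ => e (k + (2 * k : ℕ) * ((l + 1 : ℕ) : ℤ))) := .of_norm_bounded g1.summable b1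
  have t1 := tsum_of_norm_bounded g1 b1
  have s0 : Summable (fun l : ℕ => e (k + (2 * k : ℕ) * (l : ℤ))) :=
    (summable_nat_add_iff (f := fun l : ℕ => e (k + (2 * k : ℕ) * (l : ℤ))) 1).mp s1
  have e2 : ∀ l : ℕ, e (k + (2 * k : ℕ) * (-((l : ℤ) + 1))) = e (k + (2 * k : ℕ) * (l : ℤ)) := by
    intro l
    rw [← hev (k + (2 * k : ℕ) * (l : ℤ))]
    congr 1; push_cast; ring
  have s2 : Summable (fun l : ℕ => e (k + (2 * k : ℕ) * (-((l : ℤ) + 1)))) := by simpa only [e2] using s0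
  have H := HasSum.of_nat_of_neg_add_one (f := fun l : ℤ => e (k + (2 * k : ℕ) * l)) s0.hasSum s2.hasSum
  have H0 := H.unique (hs k)
  simp only [e2] at H0
  rw [s0.tsum_eq_zero_add] at H0
  simp only [Nat.cast_zero, mul_zero, add_zero] at H0
  have : e k = -(∑' l : ℕ, e (k + (2 * k : ℕ) * ((l + 1 : ℕ) : ℤ))) := by
    linear_combination H0 / 2
  rw [this, norm_neg]
  exact t1.trans (le_of_eq (by rw [div_eq_mul_inv]))

lemma pow_decay (q : ℝ) (hq0 : 0 < q) (m : ℕ) : q ^ m * (1 + m * (1 - q)) ≤ 1 := by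
  induction m with
  | zero => simp
  | succ m ih =>
    refine le_trans ?_ ih
    rw [pow_succ, mul_assoc]
    gcongr
    push_cast
    have : (0 : ℝ) ≤ m := Nat.cast_nonneg m
    nlinarith [sq_nonneg (1 - q), mul_nonneg this (sq_nonneg (1 - q))]

lemma num_est (k : ℕ) (hk : 1 ≤ k) (q M : ℝ) (hq0 : 0 < q) (hq1 : q < 1)
    (E d : ℕ → ℝ) (hE : ∀ m, 0 ≤ E m) (hd : ∀ m, 0 ≤ d m)
    (h1 : ∀ n < k, E n ≤ 2 * M * q ^ (2 * k - n) / (1 - q ^ (2 * k)))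
    (h2 : E k ≤ M * q ^ (3 * k) / (1 - q ^ (2 * k)))
    (h3 : ∀ m, E (m + (k + 1)) ≤ q ^ (m + (k + 1)) * d m)
    (hds : Summable (fun m => d m ^ 2)) (hdM : ∑' m, d m ^ 2 ≤ M ^ 2) :
    Summable (fun m : ℕ => ((1 : ℝ) + m) ^ 2 * E m ^ 2) ∧
    ∑' m : ℕ, ((1 : ℝ) + m) ^ 2 * E m ^ 2 ≤ 33 * M ^ 2 * k ^ 2 * (q ^ (k + 1)) ^ 2 / (1 - q ^ 2) ^ 2 := by
  have hk' : (1 : ℝ) ≤ k := by exact_mod_cast hk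
  set K := (k : ℝ) ^ 2 * (q ^ (k + 1)) ^ 2 / (1 - q ^ 2) ^ 2 with hK
  have hq2 : 0 < 1 - q ^ 2 := by nlinarith
  have hqk : q ^ (2 * k) ≤ q ^ 2 := pow_le_pow_of_le_one hq0.le hq1.le (by omega)
  have hqk' : 1 - q ^ 2 ≤ 1 - q ^ (2 * k) := by linarith
  have hqk0 : 0 < 1 - q ^ (2 * k) := by linarith
  have tb : ∀ m : ℕ, ((1 : ℝ) + (m + (k + 1) : ℕ)) ^ 2 * E (m + (k + 1)) ^ 2 ≤ 25 * K * d m ^ 2 := by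
    intro m
    have a1 : ((m : ℝ) + k + 2) * q ^ m * (1 - q ^ 2) ≤ 5 * k := by
      have b0 := pow_decay q hq0 m
      have b1 : q ^ m ≤ 1 := pow_le_one₀ hq0.le hq1.le
      have b2 : 0 < q ^ m := by positivity
      have b3 : (m : ℝ) * q ^ m * (1 - q) ≤ 1 := by nlinarith
      have b4 : 0 ≤ (m : ℝ) * q ^ m * (1 - q) := by
        have : 0 ≤ 1 - q := by linarith
        positivity
      have b5 : (m : ℝ) * q ^ m * (1 - q ^ 2) ≤ 2 := by nlinarith
      have b6 : q ^ m * (1 - q ^ 2) ≤ 1 := by nlinarith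
      nlinarith
    have a2 : ((1 : ℝ) + (m + (k + 1) : ℕ)) * E (m + (k + 1)) ≤ 5 * (k * q ^ (k + 1) / (1 - q ^ 2)) * d m := by
      calc ((1 : ℝ) + (m + (k + 1) : ℕ)) * E (m + (k + 1)) ≤ ((1 : ℝ) + (m + (k + 1) : ℕ)) * (q ^ (m + (k + 1)) * d m) := by
            gcongr; exact h3 m
        _ = (((m : ℝ) + k + 2) * q ^ m * (1 - q ^ 2)) * (q ^ (k + 1) / (1 - q ^ 2) * d m) := by
            push_cast; rw [pow_add q m]; field_simp; ring
        _ ≤ 5 * k * (q ^ (k + 1) / (1 - q ^ 2) * d m) := by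
            gcongr
            exact mul_nonneg (by positivity) (hd m)
        _ = _ := by ring
    have a0 : 0 ≤ ((1 : ℝ) + (m + (k + 1) : ℕ)) * E (m + (k + 1)) := mul_nonneg (by positivity) (hE _)
    calc _ = (((1 : ℝ) + (m + (k + 1) : ℕ)) * E (m + (k + 1))) ^ 2 := by ring
      _ ≤ (5 * (k * q ^ (k + 1) / (1 - q ^ 2)) * d m) ^ 2 := by gcongr
      _ = _ := by rw [hK]; simp only [mul_pow, div_pow]; ring
  have ts : Summable (fun m : ℕ => ((1 : ℝ) + (m + (k + 1) : ℕ)) ^ 2 * E (m + (k + 1)) ^ 2) :=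
    Summable.of_nonneg_of_le (fun m => by positivity) tb (hds.mul_left _)
  have hsum : Summable (fun m : ℕ => ((1 : ℝ) + m) ^ 2 * E m ^ 2) :=
    (summable_nat_add_iff (f := fun m : ℕ => ((1 : ℝ) + m) ^ 2 * E m ^ 2) (k + 1)).mp ts
  refine ⟨hsum, ?_⟩
  have hK0 : 0 ≤ K := by positivity
  have tail : ∑' m : ℕ, ((1 : ℝ) + (m + (k + 1) : ℕ)) ^ 2 * E (m + (k + 1)) ^ 2 ≤ 25 * K * M ^ 2 := by
    calc _ ≤ ∑' m : ℕ, 25 * K * d m ^ 2 := ts.tsum_le_tsum tb (hds.mul_left _)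
      _ = 25 * K * ∑' m : ℕ, d m ^ 2 := tsum_mul_left
      _ ≤ _ := by gcongr
  have top : ((1 : ℝ) + k) ^ 2 * E k ^ 2 ≤ 4 * K * M ^ 2 := by
    have c1 : q ^ (3 * k) ≤ q ^ (k + 1) := pow_le_pow_of_le_one hq0.le hq1.le (by omega)
    have c2 : E k ^ 2 ≤ (M * q ^ (3 * k) / (1 - q ^ (2 * k))) ^ 2 := by
      have := hE k
      gcongr
    calc ((1 : ℝ) + k) ^ 2 * E k ^ 2 ≤ (k + k) ^ 2 * (M * q ^ (3 * k) / (1 - q ^ (2 * k))) ^ 2 := by gcongr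
      _ = 4 * k ^ 2 * M ^ 2 * ((q ^ (3 * k)) ^ 2 / (1 - q ^ (2 * k)) ^ 2) := by
          simp only [mul_pow, div_pow]; ring
      _ ≤ 4 * k ^ 2 * M ^ 2 * ((q ^ (k + 1)) ^ 2 / (1 - q ^ 2) ^ 2) := by gcongr
      _ = _ := by rw [hK]; ring
  have head : ∑ n ∈ Finset.range k, ((1 : ℝ) + n) ^ 2 * E n ^ 2 ≤ 4 * K * M ^ 2 := by
    have c1 : ∀ n ∈ Finset.range k, ((1 : ℝ) + n) ^ 2 * E n ^ 2 ≤
        (4 * k ^ 2 * M ^ 2 / (1 - q ^ (2 * k)) ^ 2 * (q ^ (k + 1)) ^ 2) * (q ^ 2) ^ (k - 1 - n) := by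
      intro n hn
      have hn' := Finset.mem_range.mp hn
      have e0 : E n ^ 2 ≤ (2 * M * q ^ (2 * k - n) / (1 - q ^ (2 * k))) ^ 2 := by
        have := hE n
        have := h1 n hn'
        gcongr
      have e1 : (1 : ℝ) + n ≤ k := by exact_mod_cast (by omega : 1 + n ≤ k)
      have e2 : q ^ (2 * k - n) = q ^ (k + 1) * q ^ (k - 1 - n) := by
        rw [← pow_add]; congr 1; omega
      calc ((1 : ℝ) + n) ^ 2 * E n ^ 2 ≤ k ^ 2 * (2 * M * q ^ (2 * k - n) / (1 - q ^ (2 * k))) ^ 2 := by gcongr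
        _ = _ := by rw [e2]; simp only [mul_pow, div_pow]; ring
    refine (Finset.sum_le_sum c1).trans ?_
    rw [← Finset.mul_sum, Finset.sum_range_reflect (fun i => (q ^ 2) ^ i) k]
    have g : (∑ i ∈ Finset.range k, (q ^ 2) ^ i) = (1 - q ^ (2 * k)) / (1 - q ^ 2) := by
      rw [geom_sum_eq (by linarith), ← pow_mul, ← neg_sub, ← neg_sub 1 (q ^ 2), neg_div_neg_eq]
    rw [g]
    calc _ = 4 * k ^ 2 * M ^ 2 * (q ^ (k + 1)) ^ 2 * (1 / ((1 - q ^ (2 * k)) * (1 - q ^ 2))) := by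
          field_simp
      _ ≤ 4 * k ^ 2 * M ^ 2 * (q ^ (k + 1)) ^ 2 * (1 / ((1 - q ^ 2) * (1 - q ^ 2))) := by gcongr
      _ = _ := by rw [hK]; field_simp
  rw [← hsum.sum_add_tsum_nat_add (k + 1), Finset.sum_range_succ]
  have : 33 * M ^ 2 * k ^ 2 * (q ^ (k + 1)) ^ 2 / (1 - q ^ 2) ^ 2 = 33 * K * M ^ 2 := by rw [hK]; ring
  rw [this]
  linarith

lemma sup_bound (f : ℝ → ℂ) (hf : ContinuousOn f (Icc (-1) 1))
    (hs : Summable (fc (fun θ => f (Real.cos θ))))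
    (hsum : Summable (fun k : ℕ => ((1 : ℝ) + k) ^ 2 * ‖chebCoeff f k‖ ^ 2))
    (hn : h1Norm f = 1) : ‖f (-1)‖ ^ 2 ≤ Real.pi / 3 := by
  have hpi := Real.pi_pos
  set h : ℝ → ℂ := fun θ => f (Real.cos θ) with hh
  have hc : Continuous h := cos_cont f hf
  have hper : Function.Periodic h (2 * Real.pi) := fun θ => by simp [hh]
  have H := fc_hasSum h hc hper hs Real.pi
  have hval : h Real.pi = f (-1) := by simp [hh]
  rw [hval] at H
  have hnorm : ∀ n : ℤ, ‖fc h n * Complex.exp (n * Real.pi * Complex.I)‖ = ‖fc h n‖ := by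
    intro n
    rw [norm_mul, show ((n : ℂ) * Real.pi * Complex.I) = ((n * Real.pi : ℝ) : ℂ) * Complex.I by push_cast; ring,
      Complex.norm_exp_ofReal_mul_I, mul_one]
  have B1 : ‖f (-1)‖ ≤ ∑' n : ℤ, ‖fc h n‖ := by
    rw [← H.tsum_eq]
    refine (norm_tsum_le_tsum_norm ?_).trans (le_of_eq ?_)
    · simp_rw [hnorm]; exact hs.norm
    · simp_rw [hnorm]
  have hnat : Summable (fun n : ℕ => ‖fc h (n : ℤ)‖) := hs.norm.comp_injective Nat.cast_injective
  have hnat1 : Summable (fun n : ℕ => ‖fc h ((n : ℤ) + 1)‖) := by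
    have := (summable_nat_add_iff 1).mpr hnat
    simpa using this
  have hneg : ∀ n : ℕ, ‖fc h (-((n : ℤ) + 1))‖ = ‖fc h ((n : ℤ) + 1)‖ := by
    intro n; rw [fc_neg h (fun θ => by simp [hh])]
  have hnat2 : Summable (fun n : ℕ => ‖fc h (-((n : ℤ) + 1))‖) := by simpa only [hneg] using hnat1
  have T := (HasSum.of_add_one_of_neg_add_one (f := fun n : ℤ => ‖fc h n‖) hnat1.hasSum hnat2.hasSum).tsum_eq
  simp only [hneg] at T
  set g : ℕ → ℝ := fun n => ‖chebCoeff f n‖ with hg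
  have g0 : g 0 = √Real.pi * ‖fc h 0‖ := by
    simp only [hg]
    rw [chebCoeff_fc f hf 0, norm_mul, Complex.norm_real]
    simp [hh]
  have g1 : ∀ n : ℕ, g (n + 1) = √(2 * Real.pi) * ‖fc h ((n : ℤ) + 1)‖ := by
    intro n
    simp only [hg]
    rw [chebCoeff_fc f hf (n + 1), norm_mul, Complex.norm_real, if_neg (Nat.succ_ne_zero n), Real.norm_of_nonneg (Real.sqrt_nonneg _)]
    push_cast
    rfl
  have hgs1 : Summable (fun n => g (n + 1)) := by
    simp_rw [g1]; exact hnat1.mul_left _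
  have hgs : Summable g := (summable_nat_add_iff 1).mp hgs1
  have B2 : ∑' n : ℤ, ‖fc h n‖ ≤ √(2 / Real.pi) * ∑' n, g n := by
    rw [T, hgs.tsum_eq_zero_add]
    simp_rw [g1, g0]
    rw [tsum_mul_left, mul_add, ← mul_assoc, ← mul_assoc, ← Real.sqrt_mul (by positivity), ← Real.sqrt_mul (by positivity)]
    rw [show 2 / Real.pi * Real.pi = 2 by field_simp, show 2 / Real.pi * (2 * Real.pi) = 2 ^ 2 by field_simp,
      Real.sqrt_sq zero_le_two]
    have : 1 ≤ √2 := by rw [Real.one_le_sqrt]; norm_num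
    nlinarith [norm_nonneg (fc h 0)]
  have hone : ∑' k : ℕ, ((1 : ℝ) + k) ^ 2 * g k ^ 2 = 1 := by
    have := hn
    rw [h1Norm, Real.sqrt_eq_one] at this
    exact this
  have zeta : ∀ n, ∑ i ∈ Finset.range n, (((1 : ℝ) + i)⁻¹) ^ 2 ≤ Real.pi ^ 2 / 6 := by
    intro n
    have hz := hasSum_zeta_two
    have hz1 : HasSum (fun i : ℕ => 1 / (((i + 1 : ℕ) : ℝ)) ^ 2) (Real.pi ^ 2 / 6) := by
      have := (hasSum_nat_add_iff' (f := fun n : ℕ => 1 / (n : ℝ) ^ 2) 1).mpr hz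
      simpa using this
    refine le_trans (le_of_eq ?_) (sum_le_hasSum (Finset.range n) (fun i _ => by positivity) hz1)
    apply Finset.sum_congr rfl
    intro i _
    push_cast
    rw [inv_pow, one_div, add_comm]
  have B3 : ∑' n, g n ≤ √(Real.pi ^ 2 / 6) := by
    apply Real.tsum_le_of_sum_range_le (fun n => norm_nonneg _)
    intro n
    apply Real.le_sqrt_of_sq_le
    have cs := Finset.sum_mul_sq_le_sq_mul_sq (Finset.range n) (fun i : ℕ => ((1 : ℝ) + i)⁻¹) (fun i : ℕ => ((1 : ℝ) + i) * g i)
    have e1 : ∑ i ∈ Finset.range n, ((1 : ℝ) + i)⁻¹ * (((1 : ℝ) + i) * g i) = ∑ i ∈ Finset.range n, g i := by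
      apply Finset.sum_congr rfl
      intro i _
      have : (1 : ℝ) + i ≠ 0 := by positivity
      field_simp
    rw [e1] at cs
    refine cs.trans ?_
    have e2 : ∑ i ∈ Finset.range n, (((1 : ℝ) + i) * g i) ^ 2 ≤ 1 := by
      refine le_trans ?_ hone.le
      simp_rw [mul_pow]
      exact hsum.sum_le_tsum _ (fun i _ => by positivity)
    refine (mul_le_mul (zeta n) e2 (Finset.sum_nonneg fun i _ => sq_nonneg _) (by positivity)).trans ?_
    rw [mul_one]
  have B4 : ‖f (-1)‖ ≤ √(2 / Real.pi) * √(Real.pi ^ 2 / 6) :=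
    (B1.trans B2).trans (by gcongr)
  calc ‖f (-1)‖ ^ 2 ≤ (√(2 / Real.pi) * √(Real.pi ^ 2 / 6)) ^ 2 := by gcongr
    _ = Real.pi / 3 := by
      rw [mul_pow, Real.sq_sqrt (by positivity), Real.sq_sqrt (by positivity)]
      field_simp; norm_num


lemma path_ftc (E : Set ℂ) (g G : ℂ → ℂ) (hg : ContinuousOn g E)
    (hG : ∀ z ∈ E, HasDerivWithinAt G (g z) E z) (c v : ℂ) (α β : ℝ) (hαβ : α ≤ β)
    (hm : ∀ u ∈ Icc α β, c + (u : ℂ) * v ∈ E) :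
    ∫ u in α..β, v * g (c + (u : ℂ) * v) = G (c + (β : ℂ) * v) - G (c + (α : ℂ) * v) := by
  have hγc : Continuous (fun u : ℝ => c + (u : ℂ) * v) := by fun_prop
  have hGc : ContinuousOn G E := fun z hz => (hG z hz).continuousWithinAt
  apply intervalIntegral.integral_eq_sub_of_hasDerivAt_of_le hαβ
    (f := fun u : ℝ => G (c + (u : ℂ) * v))
  · exact hGc.comp hγc.continuousOn hm
  · intro u hu
    have h1 : HasDerivAt (fun u : ℝ => c + (u : ℂ) * v) v u := by
      have := ((Complex.ofRealCLM.hasDerivAt (x := u)).mul_const v).const_add c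
      simpa using this
    have h2 := (hG _ (hm u (Ioo_subset_Icc_self hu))).scomp u
      (h1.hasDerivWithinAt (s := Icc α β)) hm
    have h3 := h2.hasDerivAt (Icc_mem_nhds hu.1 hu.2)
    simpa [Function.comp_def] using h3
  · apply ContinuousOn.intervalIntegrable
    rw [uIcc_of_le hαβ]
    exact continuousOn_const.mul (hg.comp hγc.continuousOn hm)

lemma ode_aux (a b x : ℝ → ℂ) (hb : Continuous b) (ha : Continuous a) (hx : Continuous x) (lam : ℂ) (hlam : lam ≠ 0)
    (heig : ∀ t ∈ Icc (-1 : ℝ) 1, Uop a b x t = lam * x t) :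
    ∀ t ∈ Icc (-1 : ℝ) 1, x t = x (-1) *
      Complex.exp ((∫ s in (-1 : ℝ)..t, a s) + (∫ s in (-1 : ℝ)..t, b s) / lam) := by
  set u : ℝ → ℂ := fun t => x 1 + ∫ s in (-1 : ℝ)..t, (Phi a s)⁻¹ * b s * x s with hu
  set B : ℝ → ℂ := fun t => ∫ s in (-1 : ℝ)..t, b s with hB
  have hPhi : Continuous (Phi a) := by
    unfold Phi
    exact Complex.continuous_exp.comp (intervalIntegral.continuous_primitive (fun _ _ => ha.intervalIntegrable _ _) _)
  have hPhi0 : ∀ t, Phi a t ≠ 0 := fun t => Complex.exp_ne_zero _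
  have hcint : Continuous (fun s => (Phi a s)⁻¹ * b s * x s) :=
    ((hPhi.inv₀ hPhi0).mul hb).mul hx
  have hud : ∀ t, HasDerivAt u ((Phi a t)⁻¹ * b t * x t) t := fun t =>
    (intervalIntegral.integral_hasDerivAt_right (hcint.intervalIntegrable _ _)
      (hcint.stronglyMeasurableAtFilter _ _) hcint.continuousAt).const_add _
  have hBd : ∀ t, HasDerivAt B (b t) t := fun t =>
    (intervalIntegral.integral_hasDerivAt_right (hb.intervalIntegrable _ _)
      (hb.stronglyMeasurableAtFilter _ _) hb.continuousAt)
  have hux : ∀ t ∈ Icc (-1 : ℝ) 1, Phi a t * u t = lam * x t := heig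
  set w : ℝ → ℂ := fun t => u t * Complex.exp (-(B t) / lam) with hw
  have hwd : ∀ t, HasDerivAt w (((Phi a t)⁻¹ * b t * x t) * Complex.exp (-(B t) / lam) +
      u t * (Complex.exp (-(B t) / lam) * (-(b t) / lam))) t := fun t =>
    (hud t).mul (((hBd t).neg.div_const lam).cexp)
  have hconst : ∀ t ∈ Icc (-1 : ℝ) 1, w t = w (-1) := by
    apply constant_of_has_deriv_right_zero
    · exact fun t _ => (hwd t).continuousAt.continuousWithinAt
    · intro t ht
      have h1 := hwd t
      have h2 := hux t (Ico_subset_Icc_self ht)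
      have h3 : ((Phi a t)⁻¹ * b t * x t) * Complex.exp (-(B t) / lam) +
        u t * (Complex.exp (-(B t) / lam) * (-(b t) / lam)) = 0 := by
        have h0 := hPhi0 t
        have h4 : x t = Phi a t * u t / lam := by rw [h2]; field_simp
        rw [h4]
        field_simp
        ring
      rw [h3] at h1
      exact h1.hasDerivWithinAt
  have hB1 : B (-1) = 0 := by simp [hB]
  have hu1 : u (-1) = x 1 := by simp [hu]
  have hP1 : Phi a (-1) = 1 := by simp [Phi]
  have hw1 : w (-1) = x 1 := by simp [hw, hB1, hu1]
  have hx1 : x 1 = lam * x (-1) := by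
    have := hux (-1) (by simp)
    rwa [hP1, hu1, one_mul] at this
  intro t ht
  have h1 := hconst t ht
  rw [hw1, hx1] at h1
  have h2 := hux t ht
  have h3 : u t = lam * x (-1) * Complex.exp (B t / lam) := by
    rw [← h1]
    simp only [hw]
    rw [mul_assoc, ← Complex.exp_add]
    rw [show -(B t) / lam + B t / lam = 0 by ring, Complex.exp_zero, mul_one]
  rw [h3] at h2
  apply mul_left_cancel₀ hlam
  rw [← h2, Complex.exp_add, Phi]
  ring

lemma ode (a b x : ℝ → ℂ) (hb : ContinuousOn b (Icc (-1) 1)) (ha : ContinuousOn a (Icc (-1) 1))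
    (hx : ContinuousOn x (Icc (-1) 1)) (lam : ℂ) (hlam : lam ≠ 0)
    (heig : ∀ t ∈ Icc (-1 : ℝ) 1, Uop a b x t = lam * x t) :
    ∀ t ∈ Icc (-1 : ℝ) 1, x t = x (-1) *
      Complex.exp ((∫ s in (-1 : ℝ)..t, a s) + (∫ s in (-1 : ℝ)..t, b s) / lam) := by
  set cl : ℝ → ℝ := fun t => max (-1) (min 1 t) with hcl
  have hclc : Continuous cl := by fun_prop
  have hclm : ∀ t, cl t ∈ Icc (-1 : ℝ) 1 := fun t => ⟨le_max_left _ _, max_le (by norm_num) (min_le_left _ _)⟩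
  have hcle : ∀ t ∈ Icc (-1 : ℝ) 1, cl t = t := fun t ht => by
    simp only [hcl]; rw [min_eq_right ht.2, max_eq_right ht.1]
  have hI : ∀ f g : ℝ → ℂ, (∀ s ∈ Icc (-1 : ℝ) 1, f s = g s) → ∀ t ∈ Icc (-1 : ℝ) 1,
      ∫ s in (-1 : ℝ)..t, f s = ∫ s in (-1 : ℝ)..t, g s := by
    intro f g hfg t ht
    apply intervalIntegral.integral_congr
    intro s hs
    rw [uIcc_of_le ht.1] at hs
    exact hfg s ⟨hs.1, hs.2.trans ht.2⟩
  have hPhi : ∀ t ∈ Icc (-1 : ℝ) 1, Phi (a ∘ cl) t = Phi a t := by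
    intro t ht
    unfold Phi
    rw [hI (a ∘ cl) a (fun s hs => by simp [hcle s hs]) t ht]
  have H := ode_aux (a ∘ cl) (b ∘ cl) (x ∘ cl) (hb.comp_continuous hclc hclm) (ha.comp_continuous hclc hclm)
    (hx.comp_continuous hclc hclm) lam hlam (by
      intro t ht
      rw [Function.comp_apply, hcle t ht, ← heig t ht]
      unfold Uop
      rw [hPhi t ht, hI _ (fun s => (Phi a s)⁻¹ * b s * x s)
        (fun s hs => by simp only [Function.comp_apply, hcle s hs, hPhi s hs]) t ht]
      simp [hcle 1 (by simp)])
  intro t ht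
  have h := H t ht
  rw [hI (a ∘ cl) a (fun s hs => by simp [hcle s hs]) t ht,
    hI (b ∘ cl) b (fun s hs => by simp [hcle s hs]) t ht] at h
  simpa [hcle t ht, hcle (-1) (by simp)] using h

lemma ellipse_convex (S s : ℝ) : Convex ℝ (ellipse S s) := by
  have h : ConvexOn ℝ univ (fun z : ℂ => (z.re / S) ^ 2 + (z.im / s) ^ 2) := by
    have hsq : ConvexOn ℝ univ (fun t : ℝ => t ^ 2) := Even.convexOn_pow even_two
    have h1 := hsq.comp_linearMap ((S⁻¹ : ℝ) • Complex.reLm)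
    have h2 := hsq.comp_linearMap ((s⁻¹ : ℝ) • Complex.imLm)
    have := h1.add h2
    refine ConvexOn.congr (f := _) (s := univ) this (fun z _ => ?_)
    simp [div_eq_inv_mul]
  have := h.convex_le 1
  convert this using 1
  ext z
  simp [ellipse, div_pow]

lemma ellipse_compact (S s : ℝ) (hS : 0 < S) (hs : 0 < s) : IsCompact (ellipse S s) := by
  apply Metric.isCompact_of_isClosed_isBounded
  · apply isClosed_le <;> fun_prop
  · rw [isBounded_iff_forall_norm_le]
    refine ⟨S + s, fun z hz => ?_⟩
    have hz' : z.re ^ 2 / S ^ 2 + z.im ^ 2 / s ^ 2 ≤ 1 := hz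
    have p1 : 0 ≤ z.re ^ 2 / S ^ 2 := by positivity
    have p2 : 0 ≤ z.im ^ 2 / s ^ 2 := by positivity
    have h1 : |z.re| ≤ S := by
      apply abs_le_of_sq_le_sq _ hS.le
      rw [← div_le_one (by positivity)]; linarith
    have h2 : |z.im| ≤ s := by
      apply abs_le_of_sq_le_sq _ hs.le
      rw [← div_le_one (by positivity)]; linarith
    exact (Complex.norm_le_abs_re_add_abs_im z).trans (add_le_add h1 h2)

lemma ellipse_real (S s : ℝ) (hfoci : S ^ 2 = s ^ 2 + 1) (t : ℝ)
    (ht : t ∈ Icc (-1 : ℝ) 1) : (t : ℂ) ∈ ellipse S s := by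
  simp only [ellipse, mem_ofPred_eq, Complex.ofReal_re, Complex.ofReal_im]
  have : 0 < S ^ 2 := by rw [hfoci]; positivity
  rw [zero_pow two_ne_zero, zero_div, add_zero, div_le_one this]
  have := abs_le.mpr ht
  nlinarith [sq_abs t, abs_nonneg t, sq_nonneg s]

lemma seg_prim (S s : ℝ) (hfoci : S ^ 2 = s ^ 2 + 1)
    (O : Set ℂ) (hEO : ellipse S s ⊆ O) (g : ℂ → ℂ) (hg : DifferentiableOn ℂ g O) :
    ∃ G : ℂ → ℂ, (∀ z ∈ ellipse S s, HasDerivWithinAt G (g z) (ellipse S s) z) ∧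
      (∀ z ∈ ellipse S s, segInt g z = G z - G (-1)) ∧
      (∀ a : ℝ → ℂ, (∀ t ∈ Icc (-1 : ℝ) 1, g ((t : ℝ) : ℂ) = a t) →
        ∀ t ∈ Icc (-1 : ℝ) 1, ∫ u in (-1 : ℝ)..t, a u = G t - G (-1)) := by
  have hgE := hg.mono hEO
  obtain ⟨G, hG⟩ := (ellipse_convex S s).exists_forall_hasDerivWithinAt hgE
  have hm1 : (-1 : ℂ) ∈ ellipse S s := by
    have := ellipse_real S s hfoci (-1) (by simp)
    simpa using this
  refine ⟨G, hG, ?_, ?_⟩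
  · intro z hz
    have := path_ftc _ g G hgE.continuousOn hG (-1) (z + 1) 0 1 zero_le_one (by
      intro u hu
      have := (ellipse_convex S s) hm1 hz (sub_nonneg.2 hu.2) hu.1 (by ring)
      convert this using 1
      simp only [Complex.real_smul]
      push_cast
      ring)
    rw [segInt, ← intervalIntegral.integral_const_mul, this]
    simp
  · intro a ha t ht
    have := path_ftc _ g G hgE.continuousOn hG 0 1 (-1) t ht.1 (by
      intro u hu
      simpa using ellipse_real S s hfoci u ⟨hu.1, hu.2.trans ht.2⟩)
    simp only [one_mul, mul_one, zero_add] at this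
    rw [show ((-1 : ℝ) : ℂ) = -1 by simp] at this
    rw [← this]
    apply intervalIntegral.integral_congr
    intro u hu
    rw [uIcc_of_le ht.1] at hu
    exact (ha u ⟨hu.1, hu.2.trans ht.2⟩).symm

lemma seg_bound (S s : ℝ) (hS : 0 < S) (hs : 0 < s) (g G : ℂ → ℂ)
    (hG : ∀ z ∈ ellipse S s, HasDerivWithinAt G (g z) (ellipse S s) z)
    (hseg : ∀ z ∈ ellipse S s, segInt g z = G z - G (-1)) (z : ℂ) (hz : z ∈ ellipse S s) :
    ‖G z - G (-1)‖ ≤ sSup ((fun z => ‖segInt g z‖) '' ellipse S s) := by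
  rw [← hseg z hz]
  apply le_csSup _ (mem_image_of_mem (fun z => ‖segInt g z‖) hz)
  apply (ellipse_compact S s hS hs).bddAbove_image
  have hGc : ContinuousOn G (ellipse S s) := fun z hz => (hG z hz).continuousWithinAt
  have h1 : ContinuousOn (fun z => ‖G z - G (-1)‖) (ellipse S s) :=
    (hGc.sub continuousOn_const).norm
  exact h1.congr (fun z hz => by simp only [hseg z hz])

lemma analytic_ext
    (a b : ℝ → ℂ) (S s : ℝ)
    (hs : 0 < s) (hfoci : S ^ 2 = s ^ 2 + 1) (hgt : 1 < S + s)
    (O : Set ℂ) (hEO : ellipse S s ⊆ O)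
    (aC bC : ℂ → ℂ)
    (haC : DifferentiableOn ℂ aC O) (hbC : DifferentiableOn ℂ bC O)
    (haext : ∀ t ∈ Icc (-1 : ℝ) 1, aC ((t : ℝ) : ℂ) = a t)
    (hbext : ∀ t ∈ Icc (-1 : ℝ) 1, bC ((t : ℝ) : ℂ) = b t)
    (AE BE : ℝ)
    (hAE : AE = sSup ((fun z => ‖segInt aC z‖) '' ellipse S s))
    (hBE : BE = sSup ((fun z => ‖segInt bC z‖) '' ellipse S s))
    (x : ℝ → ℂ) (hxcont : ContinuousOn x (Icc (-1 : ℝ) 1))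
    (lam : ℂ) (hlam : lam ≠ 0)
    (heig : ∀ t ∈ Icc (-1 : ℝ) 1, Uop a b x t = lam * x t) :
    ∃ Y : ℂ → ℂ, ContinuousOn Y (ellipse S s) ∧
      (∀ z : ℂ, z.re ^ 2 / S ^ 2 + z.im ^ 2 / s ^ 2 < 1 → DifferentiableAt ℂ Y z) ∧
      (∀ t ∈ Icc (-1 : ℝ) 1, x t = Y t) ∧
      (∀ z ∈ ellipse S s, ‖Y z‖ ≤ ‖x (-1)‖ * Real.exp (AE + BE / ‖lam‖)) := by
  obtain ⟨hS, -⟩ := ellipse_aux S s hs hfoci hgt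
  obtain ⟨GA, hA1, hA2, hA3⟩ := seg_prim S s hfoci O hEO aC haC
  obtain ⟨GB, hB1, hB2, hB3⟩ := seg_prim S s hfoci O hEO bC hbC
  have hca : ∀ (g : ℂ → ℂ) (c : ℝ → ℂ), DifferentiableOn ℂ g O →
      (∀ t ∈ Icc (-1 : ℝ) 1, g ((t : ℝ) : ℂ) = c t) → ContinuousOn c (Icc (-1 : ℝ) 1) := by
    intro g c hg hc
    have h1 : ContinuousOn (fun t : ℝ => g (t : ℂ)) (Icc (-1 : ℝ) 1) :=
      hg.continuousOn.comp Complex.continuous_ofReal.continuousOn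
        (fun t ht => hEO (ellipse_real S s hfoci t ht))
    exact h1.congr (fun t ht => (hc t ht).symm)
  have hode := ode a b x (hca bC b hbC hbext) (hca aC a haC haext) hxcont lam hlam heig
  have hGAc : ContinuousOn GA (ellipse S s) := fun z hz => (hA1 z hz).continuousWithinAt
  have hGBc : ContinuousOn GB (ellipse S s) := fun z hz => (hB1 z hz).continuousWithinAt
  refine ⟨fun z => x (-1) * Complex.exp ((GA z - GA (-1)) + (GB z - GB (-1)) / lam), ?_, ?_, ?_, ?_⟩
  · exact continuousOn_const.mul (Complex.continuous_exp.comp_continuousOn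
      ((hGAc.sub continuousOn_const).add ((hGBc.sub continuousOn_const).div_const _)))
  · intro z hz
    have hopen : IsOpen {z : ℂ | z.re ^ 2 / S ^ 2 + z.im ^ 2 / s ^ 2 < 1} := by
      apply isOpen_lt <;> fun_prop
    have hn : ellipse S s ∈ nhds z :=
      Filter.mem_of_superset (hopen.mem_nhds hz) (by
        intro w hw
        have h1 : w.re ^ 2 / S ^ 2 + w.im ^ 2 / s ^ 2 < 1 := hw
        exact h1.le)
    have d1 := ((hA1 z (mem_of_mem_nhds hn)).hasDerivAt hn).differentiableAt
    have d2 := ((hB1 z (mem_of_mem_nhds hn)).hasDerivAt hn).differentiableAt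
    fun_prop
  · intro t ht
    rw [hode t ht, hA3 a haext t ht, hB3 b hbext t ht]
  · intro z hz
    rw [norm_mul, Complex.norm_exp]
    gcongr
    refine (Complex.re_le_norm _).trans ((norm_add_le _ _).trans ?_)
    rw [norm_div]
    gcongr
    · rw [hAE]; exact seg_bound S s hS hs aC GA hA1 hA2 z hz
    · rw [hBE]; exact seg_bound S s hS hs bC GB hB1 hB2 z hz

lemma node_zero (k : ℕ) (hk : 1 ≤ k) (f : ℝ → ℂ)
    (hf : ∀ j ≤ k, f (Real.cos (j * Real.pi / k)) = 0) (j : ℕ) (hj : j < 2 * k) :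
    f (Real.cos (2 * Real.pi * j / (2 * k : ℕ))) = 0 := by
  have hk0 : (k : ℝ) ≠ 0 := by positivity
  have e1 : 2 * Real.pi * j / (2 * k : ℕ) = j * Real.pi / k := by
    push_cast; field_simp
  rw [e1]
  rcases le_or_gt j k with h | h
  · exact hf j h
  · have h2 := hf (2 * k - j) (by omega)
    rw [Nat.cast_sub hj.le] at h2
    have e2 : ((2 * k : ℕ) - (j : ℝ)) * Real.pi / k = 2 * Real.pi - j * Real.pi / k := by
      push_cast; field_simp
    rwa [e2, Real.cos_two_pi_sub] at h2

lemma int_summable_of_even (c : ℤ → ℂ) (hev : ∀ m, c (-m) = c m) (N : ℕ) (M q : ℝ)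
    (hq0 : 0 < q) (hq1 : q < 1) (h : ∀ m : ℕ, N < m → ‖c m‖ ≤ M * q ^ m) : Summable c := by
  have h1 : Summable (fun m : ℕ => c m) := by
    rw [← summable_nat_add_iff (N + 1)]
    apply Summable.of_norm_bounded (g := fun m : ℕ => M * q ^ (m + (N + 1)))
    · exact ((summable_nat_add_iff (N + 1)).2 (summable_geometric_of_lt_one hq0.le hq1)).mul_left M
    · intro m
      exact h _ (by omega)
  apply Summable.of_nat_of_neg h1
  simpa only [hev] using h1

lemma final_est (k : ℕ) (hk : 1 ≤ k) (S s : ℝ)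
    (hs : 0 < s) (hfoci : S ^ 2 = s ^ 2 + 1) (hgt : 1 < S + s)
    (x : ℝ → ℂ) (hxcont : ContinuousOn x (Icc (-1 : ℝ) 1))
    (hxsummable : Summable (fun k : ℕ => ((1 : ℝ) + k) ^ 2 * ‖chebCoeff x k‖ ^ 2))
    (hxnorm : h1Norm x = 1)
    (p : Polynomial ℂ) (hpdeg : p.natDegree ≤ k)
    (hpinterp : ∀ j ≤ k,
      p.eval ((Real.cos (j * Real.pi / k) : ℝ) : ℂ) = x (Real.cos (j * Real.pi / k)))
    (Y : ℂ → ℂ) (hY : ContinuousOn Y (ellipse S s))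
    (hYd : ∀ z : ℂ, z.re ^ 2 / S ^ 2 + z.im ^ 2 / s ^ 2 < 1 → DifferentiableAt ℂ Y z)
    (hxY : ∀ t ∈ Icc (-1 : ℝ) 1, x t = Y t)
    (K : ℝ) (hK : 0 ≤ K)
    (hYM : ∀ z ∈ ellipse S s, ‖Y z‖ ≤ ‖x (-1)‖ * K) (q : ℝ) (hq : q = (S + s)⁻¹) :
    Summable (fun m : ℕ =>
        ((1 : ℝ) + m) ^ 2 * ‖chebCoeff (fun t => x t - p.eval ((t : ℝ) : ℂ)) m‖ ^ 2)
    ∧ h1Norm (fun t => x t - p.eval ((t : ℝ) : ℂ))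
        ≤ 16 * k * K * q ^ (k + 1) / (1 - q ^ 2) := by
  set M := ‖x (-1)‖ * K with hMdef
  have hM : 0 ≤ M := by positivity
  have hR : 0 < S + s := by linarith
  have hq0 : 0 < q := by rw [hq]; positivity
  have hq1 : q < 1 := by rw [hq]; exact inv_lt_one_of_one_lt₀ hgt
  set H : ℝ → ℂ := fun θ => Y (jouk (((S + s : ℝ) : ℂ) * Complex.exp (θ * Complex.I))) with hH
  have hnw : ∀ θ : ℝ, ‖((S + s : ℝ) : ℂ) * Complex.exp (θ * Complex.I)‖ = S + s := by
    intro θ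
    rw [norm_mul, Complex.norm_exp_ofReal_mul_I, mul_one, Complex.norm_real, Real.norm_of_nonneg hR.le]
  have hmem : ∀ θ : ℝ, jouk (((S + s : ℝ) : ℂ) * Complex.exp (θ * Complex.I)) ∈ ellipse S s := by
    intro θ
    apply jouk_mem S s hs hfoci hgt
    · rw [hnw]; exact hgt.le
    · rw [hnw]
  have hHc : Continuous H := by
    apply hY.comp_continuous _ hmem
    unfold jouk
    have hw : Continuous (fun θ : ℝ => ((S + s : ℝ) : ℂ) * Complex.exp (θ * Complex.I)) := by fun_prop
    have hw0 : ∀ θ : ℝ, ((S + s : ℝ) : ℂ) * Complex.exp (θ * Complex.I) ≠ 0 := by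
      intro θ h0
      have := hnw θ
      rw [h0, norm_zero] at this
      linarith
    exact (hw.add (hw.inv₀ hw0)).div_const _
  have hHp : Function.Periodic H (2 * Real.pi) := by
    intro θ
    simp only [hH]
    congr 3
    push_cast
    rw [add_mul, Complex.exp_add, Complex.exp_two_pi_mul_I, mul_one]
  have hHM : ∀ θ, ‖H θ‖ ≤ M := fun θ => hYM _ (hmem θ)
  have hcosmem : ∀ θ, Real.cos θ ∈ Icc (-1 : ℝ) 1 := fun θ => ⟨Real.neg_one_le_cos θ, Real.cos_le_one θ⟩
  set c : ℤ → ℂ := fc (fun θ => x (Real.cos θ)) with hc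
  have hshift : ∀ m : ℕ, ‖c m‖ = q ^ m * ‖fc H m‖ := by
    intro m
    have h1 := shift S s hs hfoci hgt Y hY hYd m
    have h2 : (fun θ : ℝ => Y ((Real.cos θ : ℝ) : ℂ)) = fun θ => x (Real.cos θ) := by
      funext θ
      exact (hxY _ (hcosmem θ)).symm
    rw [h2] at h1
    rw [h1, norm_mul, norm_pow, Complex.norm_real, Real.norm_of_nonneg hR.le, hq, inv_pow]
    field_simp
    rfl
  have hcb : ∀ m : ℕ, ‖c m‖ ≤ M * q ^ m := by
    intro m
    rw [hshift, mul_comm]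
    gcongr
    exact fc_bound H hHc hHp M hHM m
  have hcev : ∀ m, c (-m) = c m := fun m => fc_neg _ (fun θ => by simp [Real.cos_neg]) m
  have hcs : Summable c := int_summable_of_even c hcev 0 M q hq0 hq1 (fun m _ => hcb m)
  have hx1 := sup_bound x hxcont hcs hxsummable hxnorm
  -- the error
  set f : ℝ → ℂ := fun t => x t - p.eval ((t : ℝ) : ℂ) with hf
  have hpc : Continuous (fun t : ℝ => p.eval ((t : ℝ) : ℂ)) :=
    p.continuous.comp Complex.continuous_ofReal
  have hfc : ContinuousOn f (Icc (-1 : ℝ) 1) := hxcont.sub hpc.continuousOn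
  set e : ℤ → ℂ := fc (fun θ => f (Real.cos θ)) with he
  have hec : ∀ m : ℤ, (k : ℤ) < |m| → e m = c m := by
    intro m hm
    have h1 := fc_sub (fun θ => x (Real.cos θ)) (fun θ => p.eval ((Real.cos θ : ℝ) : ℂ))
      (cos_cont x hxcont) (hpc.comp Real.continuous_cos) m
    rw [fc_poly p k hpdeg m hm, sub_zero] at h1
    exact h1
  have hec' : ∀ m : ℕ, k < m → e m = c m := fun m hm => hec m (by
    rw [Nat.abs_cast]; exact_mod_cast hm)
  have heb : ∀ m : ℕ, k < m → ‖e m‖ ≤ M * q ^ m := fun m hm => by rw [hec' m hm]; exact hcb m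
  have heev : ∀ m, e (-m) = e m := fun m => fc_neg _ (fun θ => by simp [Real.cos_neg]) m
  have hes : Summable e := int_summable_of_even e heev k M q hq0 hq1 heb
  have hsum0 : ∀ n : ℤ, HasSum (fun l : ℤ => e (n + (2 * k : ℕ) * l)) 0 := by
    apply fold_sum (2 * k) (by omega) e
    intro j hj
    have h1 := fc_hasSum (fun θ => f (Real.cos θ)) (cos_cont f hfc)
      (fun θ => by simp [Real.cos_add_two_pi]) hes (2 * Real.pi * j / (2 * k : ℕ))
    have h2 := node_zero k hk f (fun j hj => by simp only [hf]; rw [hpinterp j hj, sub_self]) j hj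
    simp only [h2] at h1
    exact h1
  have hbes := fc_bessel H hHc hHp M hHM
  have hinj : Function.Injective (fun m : ℕ => ((m + (k + 1) : ℕ) : ℤ)) := by
    intro m n hmn
    simp only at hmn
    omega
  obtain ⟨hE1, hE2⟩ := num_est k hk q M hq0 hq1 (fun m => ‖e m‖)
    (fun m => ‖fc H ((m + (k + 1) : ℕ) : ℤ)‖) (fun _ => norm_nonneg _) (fun _ => norm_nonneg _)
    (fun n hn => fold_bound k hk e M q hM hq0 hq1 heb heev hsum0 n hn)
    (fold_bound_top k hk e M q hq0 hq1 heb heev hsum0)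
    (fun m => by rw [hec' _ (by omega), hshift])
    (hbes.1.comp_injective hinj)
    ((tsum_comp_le_tsum_of_inj hbes.1 (fun _ => by positivity) hinj).trans hbes.2)
  have hcheb : ∀ m : ℕ, ((1 : ℝ) + m) ^ 2 * ‖chebCoeff f m‖ ^ 2 ≤
      2 * Real.pi * (((1 : ℝ) + m) ^ 2 * ‖e m‖ ^ 2) := by
    intro m
    have hpi := Real.pi_pos
    have h1 : ‖chebCoeff f m‖ ^ 2 ≤ 2 * Real.pi * ‖e m‖ ^ 2 := by
      rw [chebCoeff_fc f hfc m, norm_mul, mul_pow]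
      gcongr
      rw [Complex.norm_real, Real.norm_eq_abs, sq_abs]
      split_ifs
      · rw [Real.sq_sqrt hpi.le]; linarith
      · rw [Real.sq_sqrt (by positivity)]
    calc _ ≤ ((1 : ℝ) + m) ^ 2 * (2 * Real.pi * ‖e m‖ ^ 2) := by gcongr
      _ = _ := by ring
  have hsumf : Summable (fun m : ℕ => ((1 : ℝ) + m) ^ 2 * ‖chebCoeff f m‖ ^ 2) :=
    Summable.of_nonneg_of_le (fun m => by positivity) hcheb (hE1.mul_left _)
  refine ⟨hsumf, ?_⟩
  have hq2 : 0 < 1 - q ^ 2 := by nlinarith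
  rw [h1Norm]
  apply Real.sqrt_le_iff.2
  refine ⟨by positivity, ?_⟩
  have hpi := Real.pi_pos
  have t1 := hsumf.tsum_le_tsum hcheb (hE1.mul_left _)
  rw [tsum_mul_left] at t1
  refine t1.trans ?_
  have hpi2 : 22 * Real.pi ^ 2 ≤ 256 := by nlinarith [Real.pi_lt_d2]
  have hM2 : M ^ 2 ≤ Real.pi / 3 * K ^ 2 := by
    rw [hMdef, mul_pow]; gcongr
  calc _ ≤ 2 * Real.pi * (33 * M ^ 2 * k ^ 2 * (q ^ (k + 1)) ^ 2 / (1 - q ^ 2) ^ 2) := by gcongr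
    _ ≤ 2 * Real.pi * (33 * (Real.pi / 3 * K ^ 2) * k ^ 2 * (q ^ (k + 1)) ^ 2 / (1 - q ^ 2) ^ 2) := by
      gcongr
    _ = 22 * Real.pi ^ 2 * (K ^ 2 * k ^ 2 * (q ^ (k + 1)) ^ 2 / (1 - q ^ 2) ^ 2) := by ring
    _ ≤ 256 * (K ^ 2 * k ^ 2 * (q ^ (k + 1)) ^ 2 / (1 - q ^ 2) ^ 2) := by gcongr
    _ = _ := by
      rw [div_pow]
      ring

/-- interpolation error for eigenfunctions of the monodromy operator. -/
theorem eigenfunction_interpolation_error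
    (k : ℕ) (hk : 1 ≤ k)
    (a b : ℝ → ℂ) (S s η : ℝ)
    (hs : 0 < s) (hfoci : S ^ 2 = s ^ 2 + 1)
    (hη : S + s = Real.exp η) (hgt : 1 < S + s)
    (O : Set ℂ) (hO : IsOpen O) (hEO : ellipse S s ⊆ O)
    (aC bC : ℂ → ℂ)
    (haC : DifferentiableOn ℂ aC O) (hbC : DifferentiableOn ℂ bC O)
    (haext : ∀ t ∈ Icc (-1 : ℝ) 1, aC ((t : ℝ) : ℂ) = a t)
    (hbext : ∀ t ∈ Icc (-1 : ℝ) 1, bC ((t : ℝ) : ℂ) = b t)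
    (AE BE : ℝ)
    (hAE : AE = sSup ((fun z => ‖segInt aC z‖) '' ellipse S s))
    (hBE : BE = sSup ((fun z => ‖segInt bC z‖) '' ellipse S s))
    (x : ℝ → ℂ) (hxcont : ContinuousOn x (Icc (-1 : ℝ) 1))
    (lam : ℂ) (hlam : lam ≠ 0)
    (heig : ∀ t ∈ Icc (-1 : ℝ) 1, Uop a b x t = lam * x t)
    (hxsummable : Summable (fun k : ℕ => ((1 : ℝ) + k) ^ 2 * ‖chebCoeff x k‖ ^ 2))
    (hxnorm : h1Norm x = 1)
    (p : Polynomial ℂ) (hpdeg : p.natDegree ≤ k)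
    (hpinterp : ∀ j ≤ k,
      p.eval ((Real.cos (j * Real.pi / k) : ℝ) : ℂ) = x (Real.cos (j * Real.pi / k))) :
    Summable (fun m : ℕ =>
        ((1 : ℝ) + m) ^ 2 * ‖chebCoeff (fun t => x t - p.eval ((t : ℝ) : ℂ)) m‖ ^ 2)
    ∧ h1Norm (fun t => x t - p.eval ((t : ℝ) : ℂ))
        ≤ 8 * (Real.sinh η)⁻¹ * Real.exp (AE + BE / ‖lam‖) * k * Real.exp (-(k : ℝ) * η) := by
  obtain ⟨Y, hY, hYd, hxY, hYM⟩ := analytic_ext a b S s hs hfoci hgt O hEO aC bC haC hbC haext hbext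
    AE BE hAE hBE x hxcont lam hlam heig
  obtain ⟨h1, h2⟩ := final_est k hk S s hs hfoci hgt x hxcont hxsummable hxnorm p hpdeg hpinterp
    Y hY hYd hxY (Real.exp (AE + BE / ‖lam‖)) (Real.exp_pos _).le hYM (Real.exp (-η))
    (by rw [hη, Real.exp_neg])
  refine ⟨h1, h2.trans (le_of_eq ?_)⟩
  have hη0 : 0 < η := by
    rw [hη] at hgt
    exact Real.one_lt_exp_iff.1 hgt
  have e1 : Real.exp (-(k : ℝ) * η) = Real.exp (-η) ^ k := by
    rw [← Real.exp_nat_mul]; congr 1; ring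
  have hq0 := Real.exp_pos (-η)
  have hq1 : Real.exp (-η) < 1 := by rw [← Real.exp_zero]; exact Real.exp_lt_exp.2 (by linarith)
  have e2 : Real.exp η = (Real.exp (-η))⁻¹ := by rw [Real.exp_neg, inv_inv]
  rw [e1, Real.sinh_eq, e2]
  set q := Real.exp (-η)
  have hq2 : 1 - q ^ 2 ≠ 0 := by nlinarith
  have e3 : ((q⁻¹ - q) / 2)⁻¹ = 2 * q / (1 - q ^ 2) := by
    have : (q⁻¹ - q) / 2 = (1 - q ^ 2) / (2 * q) := by field_simp
    rw [this, inv_div]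
  rw [e3, pow_succ]
  ring
end

section
/- Let X be a nontrivial complex Hilbert space, let V : ℓ²(ℕ, ℂ) → X be a continuous linear bijection with continuous inverse, let λ : ℕ → ℂ be a bounded sequence, and let Λ be the bounded diagonal operator on ℓ²(ℕ, ℂ) given by (Λu)_j = λ_j·u_j. Set A = V ∘ Λ ∘ V^{-1}, a bounded operator on X. If B is a bounded operator on X and x ∈ X, μ ∈ ℂ satisfy B x = μ x with ‖x‖ = 1, then there exists ν in the spectrum of A with |μ − ν| ≤ ‖V‖·‖V^{-1}‖·‖(B − A)x‖. -/
open scoped ENNReal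

/-- Bauer–Fike-type theorem for diagonalizable operators on a
Hilbert space. -/
theorem bauer_fike_hilbert
    {X : Type*} [NormedAddCommGroup X] [InnerProductSpace ℂ X] [CompleteSpace X]
    [Nontrivial X]
    (V : lp (fun _ : ℕ => ℂ) 2 ≃L[ℂ] X)
    (lam : ℕ → ℂ) (hlam : BddAbove (Set.range fun n => ‖lam n‖))
    (Lam : lp (fun _ : ℕ => ℂ) 2 →L[ℂ] lp (fun _ : ℕ => ℂ) 2)
    (hLam : ∀ (u : lp (fun _ : ℕ => ℂ) 2) (j : ℕ), (Lam u : ∀ _ : ℕ, ℂ) j = lam j * (u : ∀ _ : ℕ, ℂ) j)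
    (A : X →L[ℂ] X)
    (hA : A = (V : lp (fun _ : ℕ => ℂ) 2 →L[ℂ] X).comp
        (Lam.comp (V.symm : X →L[ℂ] lp (fun _ : ℕ => ℂ) 2)))
    (B : X →L[ℂ] X) (x : X) (μ : ℂ) (hx : ‖x‖ = 1) (hBx : B x = μ • x) :
    ∃ ν ∈ spectrum ℂ A,
      ‖μ - ν‖ ≤ ‖(V : lp (fun _ : ℕ => ℂ) 2 →L[ℂ] X)‖
          * ‖(V.symm : X →L[ℂ] lp (fun _ : ℕ => ℂ) 2)‖ * ‖(B - A) x‖ := by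
  have hev : ∀ j, lam j ∈ spectrum ℂ A := by
    intro j
    rw [spectrum.mem_iff]
    intro hu
    obtain ⟨C, hC⟩ := hu.exists_left_inv
    have hL : Lam (lp.single 2 j (1 : ℂ)) = lam j • lp.single 2 j (1 : ℂ) := by
      ext i
      rw [hLam]
      by_cases h : i = j
      · subst h; simp
      · simp [lp.single_apply, h]
    have hz : (algebraMap ℂ (X →L[ℂ] X) (lam j) - A) (V (lp.single 2 j (1 : ℂ))) = 0 := by
      simp [hA, hL, Algebra.algebraMap_eq_smul_one]
    have h0 : V (lp.single 2 j (1 : ℂ)) = 0 := by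
      have := congrArg (fun T : X →L[ℂ] X => T (V (lp.single 2 j (1 : ℂ)))) hC
      simp only [mul_apply_eq_comp, hz, map_zero, one_apply_eq_self] at this
      exact this.symm
    have h1 : (lp.single 2 j (1 : ℂ) : lp (fun _ : ℕ => ℂ) 2) = 0 := by
      simpa using h0
    have h2 := congrArg (fun u : lp (fun _ : ℕ => ℂ) 2 => (u : ∀ _ : ℕ, ℂ) j) h1
    simp at h2
  obtain ⟨ν, hν, hd⟩ := (spectrum.isCompact A).exists_infDist_eq_dist ⟨_, hev 0⟩ μ
  refine ⟨ν, hν, ?_⟩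
  have hle : ∀ j, ‖μ - ν‖ ≤ ‖μ - lam j‖ := by
    intro j
    rw [← dist_eq_norm, ← dist_eq_norm, ← hd]
    exact Metric.infDist_le_dist_of_mem (hev j)
  set y := V.symm x with hy
  have hxy : x = V y := by simp [hy]
  have hw : V.symm ((B - A) x) = μ • y - Lam y := by
    simp [hA, hBx, hy]
  have h1 : ‖μ - ν‖ * ‖y‖ ≤ ‖μ • y - Lam y‖ := by
    rw [← norm_smul]
    refine lp.norm_mono (by norm_num) ?_
    intro i
    have h : (μ • y - Lam y : lp (fun _ : ℕ => ℂ) 2) i = (μ - lam i) * y i := by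
      rw [sub_mul, ← hLam]
      rfl
    rw [h]
    simp only [lp.coeFn_smul, Pi.smul_apply, norm_smul, norm_mul]
    exact mul_le_mul_of_nonneg_right (hle i) (norm_nonneg _)
  have h2 : ‖μ • y - Lam y‖ ≤ ‖(V.symm : X →L[ℂ] lp (fun _ : ℕ => ℂ) 2)‖ * ‖(B - A) x‖ := by
    rw [← hw]
    exact (V.symm : X →L[ℂ] lp (fun _ : ℕ => ℂ) 2).le_opNorm _
  have h3 : 1 ≤ ‖(V : lp (fun _ : ℕ => ℂ) 2 →L[ℂ] X)‖ * ‖y‖ := by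
    rw [← hx]
    conv_lhs => rw [hxy]
    exact (V : lp (fun _ : ℕ => ℂ) 2 →L[ℂ] X).le_opNorm _
  calc ‖μ - ν‖ ≤ ‖μ - ν‖ * (‖(V : lp (fun _ : ℕ => ℂ) 2 →L[ℂ] X)‖ * ‖y‖) :=
        le_mul_of_one_le_right (norm_nonneg _) h3
    _ = ‖(V : lp (fun _ : ℕ => ℂ) 2 →L[ℂ] X)‖ * (‖μ - ν‖ * ‖y‖) := by ring
    _ ≤ ‖(V : lp (fun _ : ℕ => ℂ) 2 →L[ℂ] X)‖ *
        (‖(V.symm : X →L[ℂ] lp (fun _ : ℕ => ℂ) 2)‖ * ‖(B - A) x‖) :=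
        mul_le_mul_of_nonneg_left (h1.trans h2) (norm_nonneg _)
    _ = _ := by ring
end

section
/- Let X be a nontrivial complex Hilbert space, let V : ℓ²(ℕ, ℂ) → X be a continuous linear bijection with continuous inverse, let λ : ℕ → ℂ be a bounded sequence, and let Λ be the bounded diagonal operator on ℓ²(ℕ, ℂ) given by (Λu)_j = λ_j·u_j. Set A = V ∘ Λ ∘ V^{-1}. Suppose B is a bounded operator on X and x ∈ X, μ ∈ ℂ satisfy B x = μ x with ‖x‖ = 1, and suppose p ∈ X and ε > 0 satisfy ‖x − p‖ < ε. Then there exists ν in the spectrum of A with |μ − ν| ≤ ‖V‖·‖V^{-1}‖·( ε·(‖B‖ + ‖A‖) + ‖(B − A)p‖ ). -/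
open scoped ENNReal

/-- Bauer–Fike-type theorem with an approximate eigenvector. -/
theorem bauer_fike_hilbert_approx
    {X : Type*} [NormedAddCommGroup X] [InnerProductSpace ℂ X] [CompleteSpace X]
    [Nontrivial X]
    (V : lp (fun _ : ℕ => ℂ) 2 ≃L[ℂ] X)
    (lam : ℕ → ℂ) (hlam : BddAbove (Set.range fun n => ‖lam n‖))
    (Lam : lp (fun _ : ℕ => ℂ) 2 →L[ℂ] lp (fun _ : ℕ => ℂ) 2)
    (hLam : ∀ (u : lp (fun _ : ℕ => ℂ) 2) (j : ℕ), (Lam u : ∀ _ : ℕ, ℂ) j = lam j * (u : ∀ _ : ℕ, ℂ) j)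
    (A : X →L[ℂ] X)
    (hA : A = (V : lp (fun _ : ℕ => ℂ) 2 →L[ℂ] X).comp
        (Lam.comp (V.symm : X →L[ℂ] lp (fun _ : ℕ => ℂ) 2)))
    (B : X →L[ℂ] X) (x : X) (μ : ℂ) (hx : ‖x‖ = 1) (hBx : B x = μ • x)
    (p : X) (ε : ℝ) (hε : 0 < ε) (hxp : ‖x - p‖ < ε) :
    ∃ ν ∈ spectrum ℂ A,
      ‖μ - ν‖ ≤ ‖(V : lp (fun _ : ℕ => ℂ) 2 →L[ℂ] X)‖
          * ‖(V.symm : X →L[ℂ] lp (fun _ : ℕ => ℂ) 2)‖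
          * (ε * (‖B‖ + ‖A‖) + ‖(B - A) p‖) := by
  have hmem : ∀ j, lam j ∈ spectrum ℂ A := by
    intro j hj
    have hu : IsUnit (algebraMap ℂ (X →L[ℂ] X) (lam j) - A) := hj
    obtain ⟨w, hw⟩ := hu
    let e : lp (fun _ : ℕ => ℂ) 2 := lp.single 2 j (1 : ℂ)
    have hLe : Lam e = lam j • e := by
      ext k
      rw [hLam]
      by_cases hk : k = j
      · subst hk; simp [e]
      · simp [e, hk]
    have h0 : (algebraMap ℂ (X →L[ℂ] X) (lam j) - A) (V e) = 0 := by
      simp [hA, hLe, Algebra.algebraMap_eq_smul_one]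
    have h1 : (((w⁻¹ : (X →L[ℂ] X)ˣ) : X →L[ℂ] X) * (w : X →L[ℂ] X)) (V e) = 0 := by
      rw [mul_apply_eq_comp, hw, h0, map_zero]
    rw [Units.inv_mul] at h1
    have h2 : e = 0 := by simpa using h1
    have h3 : (e : ∀ _ : ℕ, ℂ) j = 0 := by rw [h2]; rfl
    simp [e] at h3
  obtain ⟨ν, hν, hd⟩ := (spectrum.isCompact A).exists_infDist_eq_dist (spectrum.nonempty A) μ
  refine ⟨ν, hν, ?_⟩
  rw [← dist_eq_norm]
  have hdj : ∀ j, dist μ ν ≤ ‖μ - lam j‖ := by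
    intro j
    rw [← hd, ← dist_eq_norm]
    exact Metric.infDist_le_dist_of_mem (hmem j)
  set d := dist μ ν with hdd
  have hd0 : 0 ≤ d := dist_nonneg
  set u := V.symm x with hu
  have hVu : V u = x := by simp [hu]
  have key : d * ‖u‖ ≤ ‖μ • u - Lam u‖ := by
    have h1 : ‖(d : ℂ) • u‖ ≤ ‖μ • u - Lam u‖ := by
      apply lp.norm_mono (by norm_num)
      intro j
      have : (μ • u - Lam u : lp (fun _ : ℕ => ℂ) 2) j = (μ - lam j) * u j := by
        rw [sub_mul, ← hLam]
        rfl
      rw [this]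
      simp only [lp.coeFn_smul, Pi.smul_apply, smul_eq_mul, norm_mul, Complex.norm_real,
        Real.norm_of_nonneg hd0]
      exact mul_le_mul_of_nonneg_right (hdj j) (norm_nonneg _)
    rwa [norm_smul, Complex.norm_real, Real.norm_of_nonneg hd0] at h1
  have hres : μ • u - Lam u = V.symm ((B - A) x) := by
    simp [hA, hBx, hu]
  have hx1 : 1 ≤ ‖(V : lp (fun _ : ℕ => ℂ) 2 →L[ℂ] X)‖ * ‖u‖ := by
    have := (V : lp (fun _ : ℕ => ℂ) 2 →L[ℂ] X).le_opNorm u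
    simpa [hVu, hx] using this
  have h2 : ‖V.symm ((B - A) x)‖ ≤
      ‖(V.symm : X →L[ℂ] lp (fun _ : ℕ => ℂ) 2)‖ * ‖(B - A) x‖ :=
    (V.symm : X →L[ℂ] lp (fun _ : ℕ => ℂ) 2).le_opNorm _
  have h3 : ‖(B - A) x‖ ≤ ε * (‖B‖ + ‖A‖) + ‖(B - A) p‖ := by
    calc ‖(B - A) x‖ = ‖(B - A) (x - p) + (B - A) p‖ := by rw [← map_add, sub_add_cancel]
      _ ≤ ‖(B - A) (x - p)‖ + ‖(B - A) p‖ := norm_add_le _ _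
      _ ≤ ‖B - A‖ * ‖x - p‖ + ‖(B - A) p‖ := by gcongr; exact (B - A).le_opNorm _
      _ ≤ (‖B‖ + ‖A‖) * ε + ‖(B - A) p‖ := by gcongr; exact norm_sub_le _ _
      _ = _ := by ring
  rw [hres] at key
  calc d ≤ d * (‖(V : lp (fun _ : ℕ => ℂ) 2 →L[ℂ] X)‖ * ‖u‖) := le_mul_of_one_le_right hd0 hx1
    _ = ‖(V : lp (fun _ : ℕ => ℂ) 2 →L[ℂ] X)‖ * (d * ‖u‖) := by ring
    _ ≤ ‖(V : lp (fun _ : ℕ => ℂ) 2 →L[ℂ] X)‖ *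
        (‖(V.symm : X →L[ℂ] lp (fun _ : ℕ => ℂ) 2)‖ *
          (ε * (‖B‖ + ‖A‖) + ‖(B - A) p‖)) := by
        refine mul_le_mul_of_nonneg_left ?_ (norm_nonneg _)
        exact key.trans (h2.trans (mul_le_mul_of_nonneg_left h3 (norm_nonneg _)))
    _ = _ := by ring
end

section
/- Let N ≥ 1 and d ≥ 1. Let A be a continuous ℂ^{d×d}-valued function on [-1,1], let u : [-1,1] → ℂ^d be continuous, and let y_0 ∈ ℂ^d. Let Φ_A : [-1,1] → ℂ^{d×d} be differentiable with Φ_A'(t) = A(t)·Φ_A(t), Φ_A(−1) = I_d, and Φ_A(t) invertible for every t, and suppose |Φ_A(t)·Φ_A(s)^{-1}| ≤ C_A whenever −1 ≤ s ≤ t ≤ 1. Suppose y : [-1,1] → ℂ^d is differentiable with y'(t) = A(t)·y(t) + u(t) and y(−1) = y_0, and suppose p is a ℂ^d-valued polynomial of degree ≤ N with p'(t_j) = A(t_j)·p(t_j) + u(t_j) for j = 0,…,N−1 and p(−1) = y_0. Set R_p = p'(−1) − A(−1)·y_0 − u(−1). Then ‖y − p‖_∞ ≤ 2·C_A·[ ‖A·p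 − I_N(A·p)‖_∞ + ‖u − I_N(u)‖_∞ + |R_p| ] and ‖y' − p'‖_∞ ≤ (2·‖A‖_∞·C_A + 1)·[ ‖A·p − I_N(A·p)‖_∞ + ‖u − I_N(u)‖_∞ + |R_p| ]. -/
open Set Polynomial

/-- The Chebyshev collocation points `t_j = cos(jπ/N)`. -/
noncomputable def chebNode (N j : ℕ) : ℝ := Real.cos (j * Real.pi / N)

/-- The operator norm of a matrix induced by the Euclidean norm on `ℂ^d`. -/
noncomputable def matNorm {d : ℕ} (M : Matrix (Fin d) (Fin d) ℂ) : ℝ :=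
  ‖LinearMap.toContinuousLinearMap (Matrix.toEuclideanLin M)‖

/-- The Euclidean norm of a vector in `ℂ^d`. -/
noncomputable def evNorm {d : ℕ} (v : Fin d → ℂ) : ℝ := Real.sqrt (∑ i, ‖v i‖ ^ 2)

/-- The sup (over `[-1,1]`) of the Euclidean norm of a vector-valued function. -/
noncomputable def supNormVec {d : ℕ} (f : ℝ → Fin d → ℂ) : ℝ :=
  ⨆ t : Set.Icc (-1 : ℝ) 1, evNorm (f t)

/-- The sup (over `[-1,1]`) of the operator norm of a matrix-valued function. -/
noncomputable def supNormMat {d : ℕ} (A : ℝ → Matrix (Fin d) (Fin d) ℂ) : ℝ :=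
  ⨆ t : Set.Icc (-1 : ℝ) 1, matNorm (A t)


lemma aux_U_bound (n : ℕ) (t : ℝ) (ht : |t| ≤ 1) :
    |(Polynomial.Chebyshev.U ℝ n).eval t| ≤ n + 1 := by
  induction n with
  | zero => simp
  | succ k ih =>
    have h := Polynomial.Chebyshev.U_eq_X_mul_U_add_T ℝ (k : ℤ)
    push_cast
    rw [h]
    simp only [eval_add, eval_mul, eval_X]
    have hT : |(Polynomial.Chebyshev.T ℝ ((k : ℤ) + 1)).eval t| ≤ 1 :=
      Polynomial.Chebyshev.abs_eval_T_real_le_one _ ht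
    refine (abs_add_le _ _).trans ?_
    rw [abs_mul]
    have := mul_le_mul ht ih (abs_nonneg _) zero_le_one
    linarith

lemma aux_node_inj (N : ℕ) (hN : 1 ≤ N) (i j : ℕ) (hi : i ≤ N) (hj : j ≤ N)
    (h : chebNode N i = chebNode N j) : i = j := by
  have hN' : (0 : ℝ) < N := by exact_mod_cast hN
  have key : ∀ k : ℕ, k ≤ N → (k * Real.pi / N : ℝ) ∈ Icc 0 Real.pi := by
    intro k hk
    have hk' : (k : ℝ) ≤ N := by exact_mod_cast hk
    refine ⟨by positivity, ?_⟩
    rw [div_le_iff₀ hN']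
    nlinarith [Real.pi_pos]
  have := Real.injOn_cos (key i hi) (key j hj) h
  have hpi := Real.pi_pos.ne'
  field_simp at this
  exact_mod_cast this

lemma aux_node_last (N : ℕ) (hN : 1 ≤ N) : chebNode N N = -1 := by
  have hN' : (N : ℝ) ≠ 0 := by positivity
  unfold chebNode
  rw [mul_div_cancel_left₀ _ hN', Real.cos_pi]

lemma aux_U_zero (n j : ℕ) (h0 : 0 < j) (hj : j < n + 1) :
    (Polynomial.Chebyshev.U ℝ n).eval (chebNode (n + 1) j) = 0 := by
  have h := Polynomial.Chebyshev.U_real_cos (j * Real.pi / ((n + 1 : ℕ) : ℝ)) (n : ℤ)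
  have hn : ((n : ℝ) + 1) ≠ 0 := by positivity
  have h2 : (((n : ℤ) : ℝ) + 1) * (j * Real.pi / ((n + 1 : ℕ) : ℝ)) = j * Real.pi := by
    push_cast; field_simp
  rw [h2, Real.sin_nat_mul_pi] at h
  have hj' : (j : ℝ) < n + 1 := by exact_mod_cast hj
  have h0' : (0 : ℝ) < j := by exact_mod_cast h0
  have hs : 0 < Real.sin (j * Real.pi / ((n + 1 : ℕ) : ℝ)) := by
    apply Real.sin_pos_of_pos_of_lt_pi
    · have := Real.pi_pos
      positivity
    · push_cast
      rw [div_lt_iff₀ (by positivity)]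
      nlinarith [Real.pi_pos]
  exact (mul_eq_zero.mp h).resolve_right hs.ne'

lemma aux_lagrange (N : ℕ) (hN : 1 ≤ N) (t : ℝ) (ht : t ∈ Icc (-1 : ℝ) 1) :
    ∃ l : ℝ, |l| ≤ 1 ∧ ∀ r : Polynomial ℂ, r.natDegree ≤ N →
      (∀ j < N, r.eval ((chebNode N j : ℝ) : ℂ) = 0) →
      r.eval (t : ℂ) = (l : ℂ) * r.eval ((-1 : ℝ) : ℂ) := by
  obtain ⟨n, rfl⟩ : ∃ n, N = n + 1 := ⟨N - 1, by omega⟩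
  set L : Polynomial ℝ := (1 - X) * Polynomial.Chebyshev.U ℝ n with hL
  have hLdeg : L.natDegree ≤ n + 1 := by
    refine Polynomial.natDegree_mul_le.trans ?_
    rw [Polynomial.Chebyshev.natDegree_U_natCast]
    have : (1 - X : Polynomial ℝ).natDegree ≤ 1 := by
      refine (Polynomial.natDegree_sub_le _ _).trans ?_
      simp
    omega
  have hLm : |L.eval (-1)| = 2 * (n + 1) := by
    simp only [hL, eval_mul, eval_sub, eval_one, eval_X, Polynomial.Chebyshev.U_eval_neg_one]
    rw [abs_mul, abs_mul]
    have h1 : |(((n : ℤ).negOnePow : ℤ) : ℝ)| = 1 := by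
      rcases Int.units_eq_one_or (n : ℤ).negOnePow with h | h <;> simp [h]
    rw [h1]
    have h2 : (0 : ℝ) ≤ (n : ℤ) + 1 := by push_cast; positivity
    rw [abs_of_nonneg h2]
    norm_num
  have hLt : |L.eval t| ≤ 2 * (n + 1) := by
    simp only [hL, eval_mul, eval_sub, eval_one, eval_X]
    rw [abs_mul]
    have h1 := aux_U_bound n t (abs_le.mpr ht)
    have h2 : |1 - t| ≤ 2 := by rw [abs_le]; constructor <;> linarith [ht.1, ht.2]
    exact mul_le_mul h2 h1 (abs_nonneg _) (by norm_num)
  have hpos : (0 : ℝ) < 2 * (n + 1) := by positivity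
  have hLm0 : L.eval (-1) ≠ 0 := by
    intro h; rw [h, abs_zero] at hLm; linarith
  have hLj : ∀ j < n + 1, L.eval (chebNode (n + 1) j) = 0 := by
    intro j hj
    simp only [hL, eval_mul, eval_sub, eval_one, eval_X]
    rcases Nat.eq_zero_or_pos j with rfl | h0
    · simp [chebNode]
    · rw [aux_U_zero n j h0 hj, mul_zero]
  refine ⟨L.eval t / L.eval (-1), ?_, ?_⟩
  · rw [abs_div, hLm, div_le_one hpos]; exact hLt
  · intro r hr hr0
    set Lc : Polynomial ℂ := L.map (algebraMap ℝ ℂ) with hLc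
    have hev : ∀ x : ℝ, Lc.eval (x : ℂ) = ((L.eval x : ℝ) : ℂ) := by
      intro x
      rw [hLc]
      rw [Polynomial.eval_map]
      exact Polynomial.eval₂_at_apply (algebraMap ℝ ℂ) x
    have hz : C (Lc.eval ((-1 : ℝ) : ℂ)) * r - C (r.eval ((-1 : ℝ) : ℂ)) * Lc = 0 := by
      apply Polynomial.eq_zero_of_natDegree_lt_card_of_eval_eq_zero _
        (f := fun j : Fin (n + 2) => ((chebNode (n + 1) j : ℝ) : ℂ))
      · intro a b hab
        have hab' : chebNode (n + 1) a = chebNode (n + 1) b := Complex.ofReal_injective hab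
        exact Fin.ext (aux_node_inj (n + 1) hN a b (by omega) (by omega) hab')
      · intro j
        by_cases hj : (j : ℕ) < n + 1
        · simp only [eval_sub, eval_mul, eval_C, hev, hr0 j hj, hLj j hj]
          simp
        · have : (j : ℕ) = n + 1 := by omega
          simp only [this, aux_node_last (n + 1) hN, eval_sub, eval_mul, eval_C]
          ring
      · rw [Fintype.card_fin]
        refine Nat.lt_succ_of_le ((Polynomial.natDegree_sub_le _ _).trans (max_le ?_ ?_))
        · exact (Polynomial.natDegree_C_mul_le _ _).trans hr
        · exact (Polynomial.natDegree_C_mul_le _ _).trans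
            (Polynomial.natDegree_map_le.trans hLdeg)
    have h := congrArg (Polynomial.eval (t : ℂ)) hz
    simp only [eval_sub, eval_mul, eval_C, hev, eval_zero] at h
    have hc : ((L.eval (-1) : ℝ) : ℂ) ≠ 0 := by exact_mod_cast hLm0
    push_cast at h ⊢
    field_simp
    linear_combination h

lemma aux_gronwall {V : Type*} [NormedAddCommGroup V] [NormedSpace ℂ V] [CompleteSpace V]
    (A Phi Psi : ℝ → V →L[ℂ] V) (e e' g : ℝ → V) (C K : ℝ) (hK : 0 ≤ K)
    (hPhi : ∀ t ∈ Icc (-1 : ℝ) 1, HasDerivWithinAt Phi (A t * Phi t) (Icc (-1 : ℝ) 1) t)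
    (h1 : ∀ t ∈ Icc (-1 : ℝ) 1, Phi t * Psi t = 1)
    (h2 : ∀ t ∈ Icc (-1 : ℝ) 1, Psi t * Phi t = 1)
    (hC : ∀ s t : ℝ, -1 ≤ s → s ≤ t → t ≤ 1 → ‖Phi t * Psi s‖ ≤ C)
    (he : ∀ t ∈ Icc (-1 : ℝ) 1, HasDerivWithinAt e (e' t) (Icc (-1 : ℝ) 1) t)
    (hode : ∀ t ∈ Icc (-1 : ℝ) 1, e' t = A t (e t) + g t)
    (hg : ∀ t ∈ Icc (-1 : ℝ) 1, ‖g t‖ ≤ K) (he0 : e (-1) = 0)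
    (t : ℝ) (ht : t ∈ Icc (-1 : ℝ) 1) : ‖e t‖ ≤ 2 * C * K := by
  have hC0 : 0 ≤ C := (norm_nonneg _).trans (hC t t ht.1 le_rfl ht.2)
  have hinv : ∀ s ∈ Icc (-1 : ℝ) 1, Psi s = Ring.inverse (Phi s) := by
    intro s hs
    let x : (V →L[ℂ] V)ˣ := ⟨Phi s, Psi s, h1 s hs, h2 s hs⟩
    exact (Ring.inverse_unit x).symm
  have hPsi : ∀ s ∈ Icc (-1 : ℝ) 1,
      HasDerivWithinAt Psi (-(Psi s * A s)) (Icc (-1 : ℝ) 1) s := by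
    intro s hs
    let x : (V →L[ℂ] V)ˣ := ⟨Phi s, Psi s, h1 s hs, h2 s hs⟩
    have hF : HasFDerivAt Ring.inverse
      (-ContinuousLinearMap.mulLeftRight ℝ (V →L[ℂ] V) (Psi s) (Psi s)) (Phi s) :=
      hasFDerivAt_ringInverse (𝕜 := ℝ) x
    have := hF.comp_hasDerivWithinAt s (hPhi s hs)
    have h3 := this.congr (f₁ := Psi) (fun z hz => hinv z hz) (hinv s hs)
    refine HasDerivWithinAt.congr_deriv h3 ?_
    symm
    change _ = -(Psi s * (A s * Phi s) * Psi s)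
    rw [mul_assoc, mul_assoc, h1 s hs, mul_one]
  have hz : ∀ s ∈ Icc (-1 : ℝ) 1,
      HasDerivWithinAt (fun s => (Phi t * Psi s) (e s)) ((Phi t * Psi s) (g s))
        (Icc (-1 : ℝ) 1) s := by
    intro s hs
    have ha : HasDerivWithinAt (fun s => Phi t * Psi s) (Phi t * -(Psi s * A s))
        (Icc (-1 : ℝ) 1) s := (hPsi s hs).const_mul (Phi t)
    have hb := (ContinuousLinearMap.restrictScalarsL ℂ V V ℝ ℝ).hasFDerivAt.comp_hasDerivWithinAt
      s ha
    have hc := hb.clm_apply (he s hs)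
    refine HasDerivWithinAt.congr_deriv hc ?_
    simp [hode s hs]
  have hsub : Icc (-1 : ℝ) t ⊆ Icc (-1 : ℝ) 1 := Icc_subset_Icc le_rfl ht.2
  have hm := norm_image_sub_le_of_norm_deriv_le_segment' (a := -1) (b := t) (C := C * K)
    (fun s hs => (hz s (hsub hs)).mono hsub)
    (fun s hs => by
      have hs' := hsub (Ico_subset_Icc_self hs)
      exact ((Phi t * Psi s).le_opNorm _).trans
        (mul_le_mul (hC s t hs.1 hs.2.le ht.2) (hg s hs') (norm_nonneg _) hC0))
    t ⟨ht.1, le_rfl⟩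
  rw [h1 t ht, he0, map_zero, sub_zero, one_apply_eq_self] at hm
  have : C * K * (t - -1) ≤ C * K * 2 :=
    mul_le_mul_of_nonneg_left (by linarith [ht.2]) (mul_nonneg hC0 hK)
  linarith

lemma aux_evNorm {d : ℕ} (v : Fin d → ℂ) : evNorm v = ‖WithLp.toLp 2 v‖ := by
  rw [EuclideanSpace.norm_eq]; rfl

/-- A matrix as an operator on Euclidean space. -/
noncomputable def auxOp {d : ℕ} (M : Matrix (Fin d) (Fin d) ℂ) :
    EuclideanSpace ℂ (Fin d) →L[ℂ] EuclideanSpace ℂ (Fin d) :=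
  Matrix.toEuclideanCLM (n := Fin d) (𝕜 := ℂ) M

lemma auxOp_norm {d : ℕ} (M : Matrix (Fin d) (Fin d) ℂ) : matNorm M = ‖auxOp M‖ := rfl

lemma auxOp_apply {d : ℕ} (M : Matrix (Fin d) (Fin d) ℂ) (v : Fin d → ℂ) :
    auxOp M (WithLp.toLp 2 v) = WithLp.toLp 2 (M.mulVec v) := rfl

lemma auxOp_mul {d : ℕ} (M M' : Matrix (Fin d) (Fin d) ℂ) :
    auxOp (M * M') = auxOp M * auxOp M' := by
  unfold auxOp; exact map_mul _ _ _

lemma auxOp_one {d : ℕ} : auxOp (1 : Matrix (Fin d) (Fin d) ℂ) = 1 := by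
  unfold auxOp; exact map_one _

lemma auxOp_sum {d : ℕ} (M : Matrix (Fin d) (Fin d) ℂ) :
    auxOp M = ∑ i, ∑ j, M i j • auxOp (Matrix.single i j 1) := by
  unfold auxOp
  conv_lhs => rw [Matrix.matrix_eq_sum_single M]
  simp only [map_sum]
  refine Finset.sum_congr rfl fun i _ => Finset.sum_congr rfl fun j _ => ?_
  rw [← map_smul, Matrix.smul_single, smul_eq_mul, mul_one]

lemma auxOp_deriv {d : ℕ} (M : ℝ → Matrix (Fin d) (Fin d) ℂ) (M' : Matrix (Fin d) (Fin d) ℂ)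
    (s : Set ℝ) (t : ℝ)
    (h : ∀ i j, HasDerivWithinAt (fun t' => M t' i j) (M' i j) s t) :
    HasDerivWithinAt (fun t => auxOp (M t)) (auxOp M') s t := by
  have h1 : (fun t => auxOp (M t)) =
      fun t => ∑ i, ∑ j, M t i j • auxOp (Matrix.single i j 1) := by
    funext t; exact auxOp_sum _
  rw [h1, auxOp_sum M']
  refine HasDerivWithinAt.fun_sum fun i _ => HasDerivWithinAt.fun_sum fun j _ => ?_
  exact (h i j).smul_const (auxOp (Matrix.single i j 1))

lemma auxOp_cont {d : ℕ} (M : ℝ → Matrix (Fin d) (Fin d) ℂ) (s : Set ℝ)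
    (h : ∀ i j, ContinuousOn (fun t' => M t' i j) s) :
    ContinuousOn (fun t => auxOp (M t)) s := by
  have h1 : (fun t => auxOp (M t)) =
      fun t => ∑ i, ∑ j, M t i j • auxOp (Matrix.single i j 1) := by
    funext t; exact auxOp_sum _
  rw [h1]
  refine continuousOn_finsetSum _ fun i _ => continuousOn_finsetSum _ fun j _ => ?_
  exact (h i j).smul continuousOn_const

lemma aux_toLp_cont {d : ℕ} (f : ℝ → Fin d → ℂ) (s : Set ℝ)
    (h : ∀ i, ContinuousOn (fun t => f t i) s) :
    ContinuousOn (fun t => WithLp.toLp 2 (f t)) s :=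
  (PiLp.continuousLinearEquiv 2 ℝ (fun _ : Fin d => ℂ)).symm.continuous.comp_continuousOn
    (continuousOn_pi.mpr h)

lemma aux_toLp_deriv {d : ℕ} (f : ℝ → Fin d → ℂ) (f' : Fin d → ℂ) (s : Set ℝ) (t : ℝ)
    (h : HasDerivWithinAt f f' s t) :
    HasDerivWithinAt (fun t => WithLp.toLp 2 (f t)) (WithLp.toLp 2 f') s t :=
  (PiLp.continuousLinearEquiv 2 ℝ (fun _ : Fin d =>
    ℂ)).symm.toContinuousLinearMap.hasFDerivAt.comp_hasDerivWithinAt t h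

lemma aux_le_sup (f : ℝ → ℝ) (hf : ContinuousOn f (Icc (-1 : ℝ) 1)) (t : ℝ)
    (ht : t ∈ Icc (-1 : ℝ) 1) : f t ≤ ⨆ s : Icc (-1 : ℝ) 1, f s := by
  have hb : BddAbove (range fun s : Icc (-1 : ℝ) 1 => f s) := by
    have := (isCompact_Icc.image_of_continuousOn hf).bddAbove
    rwa [image_eq_range] at this
  exact le_ciSup hb ⟨t, ht⟩

lemma aux_le_supVec {d : ℕ} (f : ℝ → Fin d → ℂ)
    (h : ∀ i, ContinuousOn (fun t => f t i) (Icc (-1 : ℝ) 1)) (t : ℝ)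
    (ht : t ∈ Icc (-1 : ℝ) 1) : ‖WithLp.toLp 2 (f t)‖ ≤ supNormVec f := by
  rw [← aux_evNorm]
  refine aux_le_sup (fun t => evNorm (f t)) ?_ t ht
  simp only [aux_evNorm]
  exact (aux_toLp_cont f _ h).norm

lemma aux_le_supMat {d : ℕ} (A : ℝ → Matrix (Fin d) (Fin d) ℂ)
    (h : ∀ i j, ContinuousOn (fun t => A t i j) (Icc (-1 : ℝ) 1)) (t : ℝ)
    (ht : t ∈ Icc (-1 : ℝ) 1) : ‖auxOp (A t)‖ ≤ supNormMat A := by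
  rw [← auxOp_norm]
  refine aux_le_sup (fun t => matNorm (A t)) ?_ t ht
  simp only [auxOp_norm]
  exact (auxOp_cont A _ h).norm


/-- a posteriori estimates for the Chebyshev collocation solution of
a linear ODE system.  Here `q` plays the role of `I_N(A·p)` and `w` of `I_N(u)`,
the componentwise interpolating polynomials of degree `≤ N` at the `N+1` Chebyshev
collocation points. -/
theorem apost_ivp_system
    (N d : ℕ) (hN : 1 ≤ N) (hd : 1 ≤ d)
    (A : ℝ → Matrix (Fin d) (Fin d) ℂ)
    (hA : ∀ i j : Fin d, ContinuousOn (fun t => A t i j) (Icc (-1 : ℝ) 1))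
    (u : ℝ → Fin d → ℂ) (hu : ∀ i : Fin d, ContinuousOn (fun t => u t i) (Icc (-1 : ℝ) 1))
    (y0 : Fin d → ℂ)
    (PhiA : ℝ → Matrix (Fin d) (Fin d) ℂ)
    (hPhiA : ∀ t ∈ Icc (-1 : ℝ) 1, ∀ i j : Fin d,
      HasDerivWithinAt (fun t' => PhiA t' i j) ((A t * PhiA t) i j) (Icc (-1 : ℝ) 1) t)
    (hPhiA0 : PhiA (-1) = 1)
    (hPhiAinv : ∀ t ∈ Icc (-1 : ℝ) 1, IsUnit (PhiA t))
    (CA : ℝ)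
    (hCA : ∀ s t : ℝ, -1 ≤ s → s ≤ t → t ≤ 1 → matNorm (PhiA t * (PhiA s)⁻¹) ≤ CA)
    (y y' : ℝ → Fin d → ℂ)
    (hy : ∀ t ∈ Icc (-1 : ℝ) 1, HasDerivWithinAt y (y' t) (Icc (-1 : ℝ) 1) t)
    (hode : ∀ t ∈ Icc (-1 : ℝ) 1, y' t = (A t).mulVec (y t) + u t)
    (hy0 : y (-1) = y0)
    (p : Fin d → Polynomial ℂ) (hpdeg : ∀ i, (p i).natDegree ≤ N)
    (hcolloc : ∀ j < N, ∀ i : Fin d,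
      (Polynomial.derivative (p i)).eval ((chebNode N j : ℝ) : ℂ)
        = (A (chebNode N j)).mulVec (fun i' => (p i').eval ((chebNode N j : ℝ) : ℂ)) i
          + u (chebNode N j) i)
    (hpinit : ∀ i : Fin d, (p i).eval ((-1 : ℝ) : ℂ) = y0 i)
    (q : Fin d → Polynomial ℂ) (hqdeg : ∀ i, (q i).natDegree ≤ N)
    (hq : ∀ j ≤ N, ∀ i : Fin d,
      (q i).eval ((chebNode N j : ℝ) : ℂ)
        = (A (chebNode N j)).mulVec (fun i' => (p i').eval ((chebNode N j : ℝ) : ℂ)) i)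
    (w : Fin d → Polynomial ℂ) (hwdeg : ∀ i, (w i).natDegree ≤ N)
    (hw : ∀ j ≤ N, ∀ i : Fin d,
      (w i).eval ((chebNode N j : ℝ) : ℂ) = u (chebNode N j) i)
    (Rp : Fin d → ℂ)
    (hRp : Rp = (fun i => (Polynomial.derivative (p i)).eval ((-1 : ℝ) : ℂ))
        - (A (-1)).mulVec y0 - u (-1)) :
    supNormVec (fun t i => y t i - (p i).eval ((t : ℝ) : ℂ))
      ≤ 2 * CA * (supNormVec (fun t i =>
            (A t).mulVec (fun i' => (p i').eval ((t : ℝ) : ℂ)) i - (q i).eval ((t : ℝ) : ℂ))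
          + supNormVec (fun t i => u t i - (w i).eval ((t : ℝ) : ℂ)) + evNorm Rp)
    ∧ supNormVec (fun t i => y' t i - (Polynomial.derivative (p i)).eval ((t : ℝ) : ℂ))
      ≤ (2 * supNormMat A * CA + 1) * (supNormVec (fun t i =>
            (A t).mulVec (fun i' => (p i').eval ((t : ℝ) : ℂ)) i - (q i).eval ((t : ℝ) : ℂ))
          + supNormVec (fun t i => u t i - (w i).eval ((t : ℝ) : ℂ)) + evNorm Rp) := by
  have hpc : ∀ (P : Polynomial ℂ), Continuous (fun t : ℝ => P.eval (t : ℂ)) := fun P =>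
    P.continuous.comp Complex.continuous_ofReal
  set S1 := supNormVec (fun t i =>
    (A t).mulVec (fun i' => (p i').eval ((t : ℝ) : ℂ)) i - (q i).eval ((t : ℝ) : ℂ)) with hS1
  set S2 := supNormVec (fun t i => u t i - (w i).eval ((t : ℝ) : ℂ)) with hS2
  set K := S1 + S2 + evNorm Rp with hK
  let v1 : ℝ → Fin d → ℂ := fun t i =>
    (A t).mulVec (fun i' => (p i').eval ((t : ℝ) : ℂ)) i - (q i).eval ((t : ℝ) : ℂ)
  let v2 : ℝ → Fin d → ℂ := fun t i => u t i - (w i).eval ((t : ℝ) : ℂ)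
  let v3 : ℝ → Fin d → ℂ := fun t i => (derivative (p i)).eval ((t : ℝ) : ℂ)
    - (q i).eval ((t : ℝ) : ℂ) - (w i).eval ((t : ℝ) : ℂ)
  have hv1 : ∀ t ∈ Icc (-1 : ℝ) 1, ‖WithLp.toLp 2 (v1 t)‖ ≤ S1 := by
    refine aux_le_supVec v1 fun i => ?_
    refine ContinuousOn.sub ?_ (hpc _).continuousOn
    simp only [Matrix.mulVec, dotProduct]
    exact continuousOn_finsetSum _ fun j _ => (hA i j).mul (hpc _).continuousOn
  have hv2 : ∀ t ∈ Icc (-1 : ℝ) 1, ‖WithLp.toLp 2 (v2 t)‖ ≤ S2 :=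
    aux_le_supVec v2 fun i => (hu i).sub (hpc _).continuousOn
  have hv3 : ∀ t ∈ Icc (-1 : ℝ) 1, ‖WithLp.toLp 2 (v3 t)‖ ≤ evNorm Rp := by
    intro t ht
    obtain ⟨l, hl, hr⟩ := aux_lagrange N hN t ht
    have hlast := aux_node_last N hN
    have h3 : v3 t = (l : ℂ) • Rp := by
      funext i
      have h4 := hr (derivative (p i) - q i - w i) ?_ ?_
      · simp only [eval_sub] at h4
        have hqN := hq N le_rfl i
        have hwN := hw N le_rfl i
        rw [hlast] at hqN hwN
        rw [hqN, hwN] at h4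
        simp only [hpinit] at h4
        simp only [hRp, Pi.smul_apply, Pi.sub_apply, smul_eq_mul]
        exact h4
      · refine (natDegree_sub_le _ _).trans (max_le ?_ (hwdeg i))
        refine (natDegree_sub_le _ _).trans (max_le ?_ (hqdeg i))
        exact (natDegree_derivative_le _).trans ((Nat.sub_le _ _).trans (hpdeg i))
      · intro j hj
        simp only [eval_sub]
        rw [hcolloc j hj i, hq j hj.le i, hw j hj.le i]
        ring
    rw [h3, WithLp.toLp_smul, norm_smul, aux_evNorm, Complex.norm_real, Real.norm_eq_abs]
    exact mul_le_of_le_one_left (norm_nonneg _) hl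
  let g : ℝ → EuclideanSpace ℂ (Fin d) := fun t => WithLp.toLp 2 (v1 t + v2 t - v3 t)
  have hg : ∀ t ∈ Icc (-1 : ℝ) 1, ‖g t‖ ≤ K := by
    intro t ht
    simp only [g, WithLp.toLp_sub, WithLp.toLp_add]
    refine (norm_sub_le _ _).trans (add_le_add ((norm_add_le _ _).trans ?_) (hv3 t ht))
    exact add_le_add (hv1 t ht) (hv2 t ht)
  have hm1 : (-1 : ℝ) ∈ Icc (-1 : ℝ) 1 := by simp
  have hK0 : 0 ≤ K := (norm_nonneg _).trans (hg _ hm1)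
  let e : ℝ → Fin d → ℂ := fun t i => y t i - (p i).eval ((t : ℝ) : ℂ)
  let e' : ℝ → Fin d → ℂ := fun t i => y' t i - (derivative (p i)).eval ((t : ℝ) : ℂ)
  have he : ∀ t ∈ Icc (-1 : ℝ) 1, HasDerivWithinAt e (e' t) (Icc (-1 : ℝ) 1) t := by
    intro t ht
    rw [hasDerivWithinAt_pi]
    intro i
    refine ((hasDerivWithinAt_pi.mp (hy t ht)) i).sub ?_
    exact ((p i).hasDerivAt (t : ℂ)).comp_ofReal.hasDerivWithinAt
  have heode : ∀ t ∈ Icc (-1 : ℝ) 1,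
      WithLp.toLp 2 (e' t) = auxOp (A t) (WithLp.toLp 2 (e t)) + g t := by
    intro t ht
    simp only [g, auxOp_apply, ← WithLp.toLp_add]
    congr 1
    have h5 : e t = y t - fun i => (p i).eval ((t : ℝ) : ℂ) := rfl
    rw [h5, Matrix.mulVec_sub]
    funext i
    simp only [e', v1, v2, v3, hode t ht, Pi.add_apply, Pi.sub_apply]
    ring
  have hdet : ∀ t ∈ Icc (-1 : ℝ) 1, IsUnit (PhiA t).det := fun t ht =>
    (Matrix.isUnit_iff_isUnit_det _).mp (hPhiAinv t ht)
  have hmain : ∀ t ∈ Icc (-1 : ℝ) 1, ‖WithLp.toLp 2 (e t)‖ ≤ 2 * CA * K := by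
    refine aux_gronwall (fun t => auxOp (A t)) (fun t => auxOp (PhiA t))
      (fun t => auxOp (PhiA t)⁻¹) (fun t => WithLp.toLp 2 (e t)) (fun t => WithLp.toLp 2 (e' t))
      g CA K hK0 ?_ ?_ ?_ ?_ ?_ heode hg ?_
    · intro t ht
      rw [← auxOp_mul]
      exact auxOp_deriv _ _ _ _ (hPhiA t ht)
    · intro t ht
      rw [← auxOp_mul, Matrix.mul_nonsing_inv _ (hdet t ht), auxOp_one]
    · intro t ht
      rw [← auxOp_mul, Matrix.nonsing_inv_mul _ (hdet t ht), auxOp_one]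
    · intro s t h1 h2 h3
      rw [← auxOp_mul, ← auxOp_norm]
      exact hCA s t h1 h2 h3
    · intro t ht
      exact aux_toLp_deriv _ _ _ _ (he t ht)
    · have : e (-1) = 0 := by
        funext i
        simp only [e, hy0, hpinit, sub_self, Pi.zero_apply]
      simp only [this, WithLp.toLp_zero]
  have : Nonempty (Icc (-1 : ℝ) 1) := ⟨⟨-1, hm1⟩⟩
  constructor
  · refine ciSup_le fun t => ?_
    rw [aux_evNorm]
    exact hmain t t.2
  · refine ciSup_le fun t => ?_
    rw [aux_evNorm]
    have h6 : ‖WithLp.toLp 2 (e' t)‖ ≤ supNormMat A * (2 * CA * K) + K := by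
      rw [heode t t.2]
      refine (norm_add_le _ _).trans (add_le_add ?_ (hg t t.2))
      refine (ContinuousLinearMap.le_opNorm _ _).trans ?_
      have h7 := aux_le_supMat A hA t t.2
      exact mul_le_mul h7 (hmain t t.2) (norm_nonneg _) ((norm_nonneg _).trans h7)
    refine h6.trans (le_of_eq ?_)
    ring
end

section
/- Let a, b : [-1,1] → ℂ be continuous and let U : C([-1,1], ℂ) → C([-1,1], ℂ) be the monodromy operator (U f)(t) = Φ_a(t)·[f(1) + ∫_{-1}^t Φ_a(s)^{-1}·b(s)·f(s) ds], where Φ_a(t) = exp(∫_{-1}^t a(s) ds). Then U is a compact linear operator on C([-1,1], ℂ) equipped with the supremum norm: the image under U of every bounded subset of C([-1,1], ℂ) is relatively compact. -/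
open Set

/-- compactness of the monodromy operator on `C([-1,1],ℂ)`.
The operator `U` on the Banach space `C([-1,1],ℂ)` (with the supremum norm) is
specified by the variation-of-parameters formula; since the integration variable
stays in `[-1,1]`, the clamped extension `Set.IccExtend` of `f` agrees with `f`
there.  The conclusion: the image under `U` of every bounded set is relatively
compact. -/
theorem monodromy_operator_compact
    (a b : ℝ → ℂ)
    (ha : ContinuousOn a (Icc (-1 : ℝ) 1)) (hb : ContinuousOn b (Icc (-1 : ℝ) 1))
    (U : C(Icc (-1 : ℝ) 1, ℂ) → C(Icc (-1 : ℝ) 1, ℂ))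
    (hU : ∀ (f : C(Icc (-1 : ℝ) 1, ℂ)) (t : Icc (-1 : ℝ) 1),
      U f t = Complex.exp (∫ s in (-1 : ℝ)..(t : ℝ), a s)
        * (f ⟨1, by norm_num⟩
          + ∫ s in (-1 : ℝ)..(t : ℝ),
              (Complex.exp (∫ r in (-1 : ℝ)..s, a r))⁻¹ * b s
                * Set.IccExtend (by norm_num : (-1 : ℝ) ≤ 1) f s)) :
    ∀ S : Set C(Icc (-1 : ℝ) 1, ℂ), Bornology.IsBounded S → IsCompact (closure (U '' S)) := by
  classical
  intro S hS
  set Φ : ℝ → ℂ := fun t => Complex.exp (∫ s in (-1 : ℝ)..t, a s) with hΦ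
  have h11 : (-1 : ℝ) ≤ 1 := by norm_num
  have hΦc : ContinuousOn Φ (Icc (-1 : ℝ) 1) := by
    have h := intervalIntegral.continuousOn_primitive_interval (μ := MeasureTheory.volume)
      (f := a) (a := -1) (b := 1) (by
        rw [uIcc_of_le h11]; exact ha.integrableOn_Icc)
    rw [uIcc_of_le h11] at h
    exact h.cexp
  have hhc : ContinuousOn (fun s => (Φ s)⁻¹ * b s) (Icc (-1 : ℝ) 1) :=
    (hΦc.inv₀ (fun x _ => Complex.exp_ne_zero _)).mul hb
  obtain ⟨M, hM⟩ := isCompact_Icc.exists_bound_of_continuousOn hhc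
  obtain ⟨P, hP⟩ := isCompact_Icc.exists_bound_of_continuousOn hΦc
  obtain ⟨R, hR⟩ := hS.exists_norm_le
  have hM0 : 0 ≤ M := (norm_nonneg _).trans (hM 1 (by norm_num))
  have hP0 : 0 ≤ P := (norm_nonneg _).trans (hP 1 (by norm_num))
  let g : C(Icc (-1 : ℝ) 1, ℂ) → ℝ → ℂ := fun f s => (Φ s)⁻¹ * b s * Set.IccExtend h11 f s
  have hgc : ∀ f, ContinuousOn (g f) (Icc (-1 : ℝ) 1) := fun f =>
    hhc.mul (f.continuous.Icc_extend').continuousOn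
  have hgb : ∀ f ∈ S, ∀ s ∈ Icc (-1 : ℝ) 1, ‖g f s‖ ≤ M * R := by
    intro f hf s hs
    have h1 : ‖Set.IccExtend h11 f s‖ ≤ R := (f.norm_coe_le_norm _).trans (hR f hf)
    calc ‖g f s‖ = ‖(Φ s)⁻¹ * b s‖ * ‖Set.IccExtend h11 f s‖ := norm_mul _ _
      _ ≤ M * R := mul_le_mul (hM s hs) h1 (norm_nonneg _) hM0
  have hgi : ∀ f, ∀ x ∈ Icc (-1 : ℝ) 1, ∀ y ∈ Icc (-1 : ℝ) 1,
      IntervalIntegrable (g f) MeasureTheory.volume x y := fun f x hx y hy =>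
    ((hgc f).mono (uIcc_subset_Icc hx hy)).intervalIntegrable
  have hm : (-1 : ℝ) ∈ Icc (-1 : ℝ) 1 := by norm_num
  have hint : ∀ f ∈ S, ∀ x ∈ Icc (-1 : ℝ) 1, ∀ y ∈ Icc (-1 : ℝ) 1,
      ‖∫ s in x..y, g f s‖ ≤ M * R * |y - x| := by
    intro f hf x hx y hy
    refine intervalIntegral.norm_integral_le_of_norm_le_const fun s hs => hgb f hf s ?_
    exact uIcc_subset_Icc hx hy (uIoc_subset_uIcc hs)
  have hG : ∀ f ∈ S, ∀ t : Icc (-1 : ℝ) 1,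
      ‖f ⟨1, by norm_num⟩ + ∫ s in (-1 : ℝ)..t, g f s‖ ≤ R + M * R * 2 := by
    intro f hf t
    have hR0 : 0 ≤ R := (norm_nonneg _).trans (hR f hf)
    refine (norm_add_le _ _).trans (add_le_add ((f.norm_coe_le_norm _).trans (hR f hf)) ?_)
    refine (hint f hf _ hm _ t.2).trans (mul_le_mul_of_nonneg_left ?_ (by positivity))
    rw [abs_le]; constructor <;> linarith [t.2.1, t.2.2]
  have hU' : ∀ f (t : Icc (-1 : ℝ) 1),
      U f t = Φ t * (f ⟨1, by norm_num⟩ + ∫ s in (-1 : ℝ)..t, g f s) := hU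
  let e := ContinuousMap.isometryEquivBoundedOfCompact (Icc (-1 : ℝ) 1) ℂ
  have key : IsCompact (closure (e '' (U '' S))) := by
    refine BoundedContinuousFunction.arzela_ascoli (Metric.closedBall 0 (P * (R + M * R * 2)))
      (isCompact_closedBall _ _) _ ?_ ?_
    · rintro _ t ⟨_, ⟨f, hf, rfl⟩, rfl⟩
      rw [mem_closedBall_zero_iff]
      change ‖U f t‖ ≤ _
      rw [hU', norm_mul]
      exact mul_le_mul (hP t t.2) (hG f hf t) (norm_nonneg _) hP0
    · intro x₀
      refine Metric.equicontinuousAt_of_continuity_modulus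
        (fun x : Icc (-1 : ℝ) 1 => ‖Φ x₀ - Φ x‖ * (R + M * R * 2)
          + P * (M * R * |(x₀ : ℝ) - x|)) ?_ _ ?_
      · have hc : Continuous (fun x : Icc (-1 : ℝ) 1 => Φ x) := hΦc.domRestrict
        have hc2 : Continuous (fun x : Icc (-1 : ℝ) 1 => ‖Φ x₀ - Φ x‖ * (R + M * R * 2)
          + P * (M * R * |(x₀ : ℝ) - x|)) :=
          ((continuous_const.sub hc).norm.mul continuous_const).add (by fun_prop)
        simpa using hc2.tendsto x₀
      · refine Filter.Eventually.of_forall fun x => ?_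
        rintro ⟨_, _, ⟨f, hf, rfl⟩, rfl⟩
        change dist (U f x₀) (U f x) ≤ _
        have hsub := intervalIntegral.integral_interval_sub_left
          (hgi f _ hm _ x₀.2) (hgi f _ hm _ x.2)
        have heq : U f x₀ - U f x = (Φ x₀ - Φ x) * (f ⟨1, by norm_num⟩ + ∫ s in (-1 : ℝ)..x₀, g f s)
            + Φ x * ∫ s in (x : ℝ)..x₀, g f s := by
          rw [hU', hU', ← hsub]; ring
        rw [dist_eq_norm, heq]
        refine (norm_add_le _ _).trans ?_
        rw [norm_mul, norm_mul]
        exact add_le_add (mul_le_mul_of_nonneg_left (hG f hf x₀) (norm_nonneg _))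
          (mul_le_mul (hP x x.2) (hint f hf _ x.2 _ x₀.2) (norm_nonneg _) hP0)
  have h2 : e '' closure (U '' S) = closure (e '' (U '' S)) := e.toHomeomorph.image_closure _
  rw [← h2] at key
  exact e.toHomeomorph.isCompact_image.1 key
end

section
/- Let a, b : [-1,1] → ℂ be continuous, let U be the associated monodromy operator, and suppose x : [-1,1] → ℂ is continuous with U x = λ x for some λ ≠ 0. Then x(t) = x(−1)·exp(∫_{-1}^t (a(s) + b(s)/λ) ds) for all t ∈ [-1,1]; consequently, if x is not identically zero, then λ = exp( ∫_{-1}^1 a(s) ds + (1/λ)·∫_{-1}^1 b(s) ds ). -/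
open Set

lemma hasDeriv_aux (g : ℝ → ℂ) (hg : ContinuousOn g (Icc (-1 : ℝ) 1)) (t : ℝ)
    (ht : t ∈ Icc (-1 : ℝ) 1) :
    HasDerivWithinAt (fun u => ∫ s in (-1 : ℝ)..u, g s) (g t) (Icc (-1 : ℝ) 1) t := by
  have h11 : (-1 : ℝ) ≤ 1 := by norm_num
  have hc : Continuous (IccExtend h11 ((Icc (-1 : ℝ) 1).restrict g)) :=
    (continuousOn_iff_continuous_restrict.1 hg).Icc_extend'
  have he : ∀ u ∈ Icc (-1 : ℝ) 1, IccExtend h11 ((Icc (-1 : ℝ) 1).restrict g) u = g u := by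
    intro u hu
    rw [IccExtend_of_mem h11 _ hu]
    rfl
  have hd := (hc.integral_hasStrictDerivAt (-1) t).hasDerivAt.hasDerivWithinAt
    (s := Icc (-1 : ℝ) 1)
  rw [he t ht] at hd
  have hi : ∀ u ∈ Icc (-1 : ℝ) 1, (∫ s in (-1 : ℝ)..u, g s) =
      ∫ s in (-1 : ℝ)..u, IccExtend h11 ((Icc (-1 : ℝ) 1).restrict g) s := by
    intro u hu
    apply intervalIntegral.integral_congr
    intro s hs
    rw [uIcc_of_le hu.1] at hs
    exact (he s ⟨hs.1, hs.2.trans hu.2⟩).symm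
  exact hd.congr hi (hi t ht)

/-- explicit form of eigenfunctions of the scalar monodromy
operator, and the characteristic equation for its nonzero eigenvalues. -/
theorem monodromy_eigenfunction_form
    (a b : ℝ → ℂ)
    (ha : ContinuousOn a (Icc (-1 : ℝ) 1)) (hb : ContinuousOn b (Icc (-1 : ℝ) 1))
    (x : ℝ → ℂ) (hx : ContinuousOn x (Icc (-1 : ℝ) 1))
    (lam : ℂ) (hlam : lam ≠ 0)
    (heig : ∀ t ∈ Icc (-1 : ℝ) 1, Uop a b x t = lam * x t) :
    (∀ t ∈ Icc (-1 : ℝ) 1,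
      x t = x (-1) * Complex.exp (∫ s in (-1 : ℝ)..t, (a s + b s / lam)))
    ∧ ((∃ t ∈ Icc (-1 : ℝ) 1, x t ≠ 0) →
        lam = Complex.exp ((∫ s in (-1 : ℝ)..1, a s)
          + (1 / lam) * ∫ s in (-1 : ℝ)..1, b s)) := by
  have h11 : (-1 : ℝ) ≤ 1 := by norm_num
  have hbl : ContinuousOn (fun s => b s / lam) (Icc (-1 : ℝ) 1) := hb.div_const lam
  have hPhi : ContinuousOn (Phi a) (Icc (-1 : ℝ) 1) := fun t ht =>
    (hasDeriv_aux a ha t ht).cexp.continuousWithinAt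
  have hne : ∀ t, Phi a t ≠ 0 := fun t => Complex.exp_ne_zero _
  have hg : ContinuousOn (fun s => (Phi a s)⁻¹ * b s * x s) (Icc (-1 : ℝ) 1) :=
    ((hPhi.inv₀ fun t _ => hne t).mul hb).mul hx
  have hder : ∀ t ∈ Icc (-1 : ℝ) 1, HasDerivWithinAt
      (fun t => (x 1 + ∫ s in (-1 : ℝ)..t, (Phi a s)⁻¹ * b s * x s) *
        Complex.exp (-∫ s in (-1 : ℝ)..t, b s / lam)) 0 (Icc (-1 : ℝ) 1) t := by
    intro t ht
    have h1 := (hasDeriv_aux _ hg t ht).const_add (x 1)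
    have h2 := (hasDeriv_aux _ hbl t ht).neg.cexp
    refine (h1.mul h2).congr_deriv ?_
    have hx' : x t = Phi a t * (x 1 + ∫ s in (-1 : ℝ)..t, (Phi a s)⁻¹ * b s * x s) / lam := by
      rw [eq_div_iff hlam, mul_comm, ← heig t ht, Uop]
    have := hne t
    simp only [Pi.neg_apply]
    generalize (∫ s in (-1 : ℝ)..t, (Phi a s)⁻¹ * b s * x s) = W at *
    rw [hx']
    field_simp
    ring
  have hconst := constant_of_derivWithin_zero (a := (-1 : ℝ)) (b := 1)
    (fun t ht => (hder t ht).differentiableWithinAt)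
    (fun t ht => (hder t ⟨ht.1, ht.2.le⟩).derivWithin
      (uniqueDiffOn_Icc (by norm_num) t ⟨ht.1, ht.2.le⟩))
  have hm1 : x 1 = lam * x (-1) := by
    have := heig (-1) (by simp)
    simpa [Uop, Phi] using this
  have key : ∀ t ∈ Icc (-1 : ℝ) 1,
      x t = x (-1) * Complex.exp (∫ s in (-1 : ℝ)..t, (a s + b s / lam)) := by
    intro t ht
    have hsub : uIcc (-1) t ⊆ Icc (-1 : ℝ) 1 := by
      rw [uIcc_of_le ht.1]
      exact Icc_subset_Icc_right ht.2
    rw [intervalIntegral.integral_add (ha.mono hsub).intervalIntegrable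
      (hbl.mono hsub).intervalIntegrable, Complex.exp_add]
    have h := hconst t ht
    simp only [intervalIntegral.integral_same, neg_zero, Complex.exp_zero, mul_one, add_zero,
      Complex.exp_neg] at h
    rw [← div_eq_mul_inv, div_eq_iff (Complex.exp_ne_zero _)] at h
    have h3 := heig t ht
    rw [Uop, h, Phi, hm1] at h3
    apply mul_left_cancel₀ hlam
    rw [← h3]
    ring
  refine ⟨key, ?_⟩
  rintro ⟨t, ht, hxt⟩
  have h0 : x (-1) ≠ 0 := by
    intro h0
    apply hxt
    rw [key t ht, h0, zero_mul]
  have h1 := key 1 (by simp)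
  have hsub : uIcc (-1) 1 ⊆ Icc (-1 : ℝ) 1 := by rw [uIcc_of_le h11]
  rw [intervalIntegral.integral_add (ha.mono hsub).intervalIntegrable
      (hbl.mono hsub).intervalIntegrable, intervalIntegral.integral_div, hm1, mul_comm] at h1
  rw [one_div_mul_eq_div]
  exact mul_left_cancel₀ h0 h1
end
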